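/- There is an absolute constant C > 0 such that for every real number x ≥ 2, | log(∏_{p≤x}(1−1/p)^{-1}) − ∑_{n≤x} Λ(n)/(n log n) − 1/(√x log x) | ≤ C/(√x (log x)²), where the product runs over primes p ≤ x and the sum over integers 2 ≤ n ≤ x. -/

import Mathlib

open Filter MeasureTheory Real Set

/-- The Mertens product `∏_{p ≤ x} (1 - 1/p)⁻¹`. -/
noncomputable def mertensProd (x : ℝ) : ℝ :=
  ∏ p ∈ Finset.filter Nat.Prime (Finset.Iic ⌊x⌋₊), ((1 : ℝ) - 1 / p)⁻¹

/-- The entire function `(s - 1) ζ(s)`. -/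
noncomputable def zetaMulSubOne : ℂ → ℂ :=
  Function.update (fun s ↦ (s - 1) * riemannZeta s) 1 1

lemma zetaMulSubOne_of_ne {s : ℂ} (hs : s ≠ 1) : zetaMulSubOne s = (s - 1) * riemannZeta s := by
  simp [zetaMulSubOne, hs]

lemma zetaMulSubOne_one : zetaMulSubOne 1 = 1 := by
  simp [zetaMulSubOne]

lemma differentiable_zetaMulSubOne : Differentiable ℂ zetaMulSubOne := by
  have key : ∀ s : ℂ, s ≠ 1 → DifferentiableAt ℂ zetaMulSubOne s := by
    intro s hs
    have h : DifferentiableAt ℂ (fun s ↦ (s - 1) * riemannZeta s) s :=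
      (by fun_prop : DifferentiableAt ℂ (fun s : ℂ ↦ s - 1) s).mul (differentiableAt_riemannZeta hs)
    refine h.congr_of_eventuallyEq ?_
    filter_upwards [isOpen_ne.mem_nhds hs] with t ht using zetaMulSubOne_of_ne ht
  intro s
  rcases ne_or_eq s 1 with hs | rfl
  · exact key s hs
  refine (Complex.analyticAt_of_differentiable_on_punctured_nhds_of_continuousAt ?_ ?_).differentiableAt
  · filter_upwards [self_mem_nhdsWithin] with t ht using key t ht
  · simpa only [zetaMulSubOne, continuousAt_update_same] using riemannZeta_residue_one

lemma zetaMulSubOne_ne_zero {s : ℂ} (hs : 1 ≤ s.re) : zetaMulSubOne s ≠ 0 := by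
  rcases eq_or_ne s 1 with rfl | h
  · simp [zetaMulSubOne_one]
  · rw [zetaMulSubOne_of_ne h]
    exact mul_ne_zero (sub_ne_zero.mpr h) (riemannZeta_ne_zero_of_one_le_re hs)

lemma norm_cpow_neg_sub_cpow_neg_le {m u : ℝ} (hm : 1 ≤ m) (hu : u ∈ Icc m (m + 1)) {s : ℂ}
    (hs : 0 ≤ s.re) :
    ‖(m : ℂ) ^ (-s) - (u : ℂ) ^ (-s)‖ ≤ 2 * ‖s‖ ^ (1 / 32 : ℝ) * m ^ (-s.re - 1 / 32) := by
  have hm0 : 0 < m := by linarith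
  have h1 : ‖(m : ℂ) ^ (-s) - (u : ℂ) ^ (-s)‖ ≤ 2 * m ^ (-s.re) := by
    refine (norm_sub_le _ _).trans ?_
    rw [Complex.norm_cpow_eq_rpow_re_of_pos hm0,
      Complex.norm_cpow_eq_rpow_re_of_pos (hm0.trans_le hu.1), two_mul, Complex.neg_re]
    exact add_le_add_right (Real.rpow_le_rpow_of_nonpos hm0 hu.1 (by linarith)) _
  have h2 : ‖(m : ℂ) ^ (-s) - (u : ℂ) ^ (-s)‖ ≤ ‖s‖ * m ^ (-s.re - 1) := by
    rcases eq_or_ne s 0 with rfl | hs0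
    · simp
    have := Convex.norm_image_sub_le_of_norm_hasDerivWithin_le (𝕜 := ℝ)
      (f := fun u : ℝ ↦ (u : ℂ) ^ (-s)) (f' := fun u : ℝ ↦ -s * (u : ℂ) ^ (-s - 1))
      (s := Icc m (m + 1)) (x := u) (y := m) (C := ‖s‖ * m ^ (-s.re - 1))
      (fun x hx ↦ (hasDerivAt_ofReal_cpow_const (by linarith [hx.1]) (neg_ne_zero.mpr hs0)).hasDerivWithinAt)
      (fun x hx ↦ ?_) (convex_Icc _ _) hu ⟨le_rfl, by linarith⟩
    · refine this.trans (mul_le_of_le_one_right (by positivity) ?_)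
      rw [Real.norm_eq_abs, abs_le]
      constructor <;> linarith [hu.1, hu.2]
    · rw [norm_mul, norm_neg, Complex.norm_cpow_eq_rpow_re_of_pos (by linarith [hx.1])]
      gcongr
      simp only [Complex.sub_re, Complex.neg_re, Complex.one_re]
      exact Real.rpow_le_rpow_of_nonpos hm0 hx.1 (by linarith)
  have e1 : m ^ (-s.re - 1) = m ^ (-s.re) * m⁻¹ := by
    rw [Real.rpow_sub hm0, Real.rpow_one, div_eq_mul_inv]
  have e2 : ‖s‖ ^ (1 / 32 : ℝ) * m ^ (-s.re - 1 / 32) = m ^ (-s.re) * (‖s‖ / m) ^ (1 / 32 : ℝ) := by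
    rw [Real.rpow_sub hm0, Real.div_rpow (norm_nonneg _) hm0.le]
    ring
  rw [mul_assoc, e2]
  rw [e1] at h2
  have hp : 0 < m ^ (-s.re) := by positivity
  have hr : 0 ≤ ‖s‖ / m := by positivity
  rcases le_total (‖s‖ / m) 1 with hle | hge
  · have : ‖s‖ / m ≤ (‖s‖ / m) ^ (1 / 32 : ℝ) := by
      rcases hr.eq_or_lt with h0 | h0
      · rw [← h0]; positivity
      · conv_lhs => rw [← Real.rpow_one (‖s‖ / m)]
        exact Real.rpow_le_rpow_of_exponent_ge h0 hle (by norm_num)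
    calc _ ≤ m ^ (-s.re) * (‖s‖ / m) := by rw [div_eq_mul_inv]; linarith [h2]
      _ ≤ m ^ (-s.re) * (‖s‖ / m) ^ (1 / 32 : ℝ) := by gcongr
      _ ≤ _ := by linarith [mul_nonneg hp.le (Real.rpow_nonneg hr (1 / 32))]
  · have : 1 ≤ (‖s‖ / m) ^ (1 / 32 : ℝ) := Real.one_le_rpow hge (by norm_num)
    nlinarith

/-- The entire summands of `(s - 1) ζ(s) - 1`. -/
noncomputable def zetaTerm (n : ℕ) (s : ℂ) : ℂ :=
  (s - 1) * ((n + 1 : ℝ) : ℂ) ^ (-s) - ((n + 1 : ℝ) : ℂ) ^ (1 - s) + ((n + 2 : ℝ) : ℂ) ^ (1 - s)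

lemma differentiable_zetaTerm (n : ℕ) : Differentiable ℂ (zetaTerm n) := by
  have h1 : ((n + 1 : ℝ) : ℂ) ≠ 0 := by exact_mod_cast (by positivity : (n + 1 : ℝ) ≠ 0)
  have h2 : ((n + 2 : ℝ) : ℂ) ≠ 0 := by exact_mod_cast (by positivity : (n + 2 : ℝ) ≠ 0)
  unfold zetaTerm
  intro s
  have a := (differentiableAt_id (𝕜 := ℂ) (x := s)).neg.const_cpow (c := ((n + 1 : ℝ) : ℂ)) (.inl h1)
  have b := ((differentiableAt_id (𝕜 := ℂ) (x := s)).const_sub 1).const_cpow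
    (c := ((n + 1 : ℝ) : ℂ)) (.inl h1)
  have c := ((differentiableAt_id (𝕜 := ℂ) (x := s)).const_sub 1).const_cpow
    (c := ((n + 2 : ℝ) : ℂ)) (.inl h2)
  exact ((((differentiableAt_id (𝕜 := ℂ) (x := s)).sub_const 1).mul a).sub b).add c

lemma norm_zetaTerm_le (n : ℕ) {s : ℂ} (hs : 63 / 64 ≤ s.re) :
    ‖zetaTerm n s‖ ≤ ‖s - 1‖ * (2 * ‖s‖ ^ (1 / 32 : ℝ)) * (n + 1 : ℝ) ^ (-65 / 64 : ℝ) := by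
  rcases eq_or_ne s 1 with rfl | hs1
  · simp [zetaTerm]
  set m : ℝ := n + 1 with hm
  have hm1 : 1 ≤ m := by simp [m]
  have hm2 : (n + 2 : ℝ) = m + 1 := by rw [hm]; ring
  have := Convex.norm_image_sub_le_of_norm_hasDerivWithin_le (𝕜 := ℝ)
      (f := fun u : ℝ ↦ (u : ℂ) * ((s - 1) * (m : ℂ) ^ (-s)) + (u : ℂ) ^ (1 - s))
      (f' := fun u : ℝ ↦ 1 * ((s - 1) * (m : ℂ) ^ (-s)) + (1 - s) * (u : ℂ) ^ (1 - s - 1))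
      (s := Icc m (m + 1)) (x := m) (y := m + 1)
      (C := ‖s - 1‖ * (2 * ‖s‖ ^ (1 / 32 : ℝ) * m ^ (-s.re - 1 / 32)))
      (fun x hx ↦ (((hasDerivAt_id _).comp_ofReal.mul_const _).add (hasDerivAt_ofReal_cpow_const
        (by linarith [hx.1]) (sub_ne_zero.mpr hs1.symm))).hasDerivWithinAt)
      (fun x hx ↦ ?_) (convex_Icc _ _) ⟨le_rfl, by linarith⟩ ⟨by linarith, le_rfl⟩
  · have e : zetaTerm n s = ((m + 1 : ℝ) : ℂ) * ((s - 1) * (m : ℂ) ^ (-s)) + ((m + 1 : ℝ) : ℂ) ^ (1 - s)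
        - ((m : ℂ) * ((s - 1) * (m : ℂ) ^ (-s)) + (m : ℂ) ^ (1 - s)) := by
      rw [zetaTerm, hm2, ← hm]
      push_cast
      ring
    rw [e]
    refine this.trans ?_
    rw [add_sub_cancel_left, norm_one, mul_one, ← mul_assoc]
    gcongr ?_ * ?_
    exact Real.rpow_le_rpow_of_exponent_le hm1 (by linarith)
  · have e : 1 * ((s - 1) * (m : ℂ) ^ (-s)) + (1 - s) * (x : ℂ) ^ (1 - s - 1)
        = (s - 1) * ((m : ℂ) ^ (-s) - (x : ℂ) ^ (-s)) := by
      rw [show 1 - s - 1 = -s by ring]; ring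
    rw [e, norm_mul]
    gcongr
    exact norm_cpow_neg_sub_cpow_neg_le hm1 hx (by linarith)

lemma summable_add_one_rpow : Summable fun n : ℕ ↦ (n + 1 : ℝ) ^ (-65 / 64 : ℝ) := by
  have := (summable_nat_add_iff 1).mpr
    (Real.summable_nat_rpow (p := (-65 / 64 : ℝ)).mpr (by norm_num))
  simpa using this

lemma zetaMulSubOne_eq_of_one_lt {s : ℂ} (hs : 1 < s.re) :
    zetaMulSubOne s = 1 + ∑' n, zetaTerm n s := by
  have hs1 : s ≠ 1 := by rintro rfl; simp at hs
  have hsum : Summable fun n ↦ zetaTerm n s :=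
    Summable.of_norm_bounded (summable_add_one_rpow.mul_left _)
      (fun n ↦ norm_zetaTerm_le n (by linarith))
  have hz : Summable fun n : ℕ ↦ 1 / ((n : ℂ) + 1) ^ s := by
    have := (summable_nat_add_iff 1).mpr (Complex.summable_one_div_nat_cpow.mpr hs)
    simpa using this
  have hlim : Tendsto (fun N : ℕ ↦ ((N + 1 : ℝ) : ℂ) ^ (1 - s)) atTop (nhds 0) := by
    rw [tendsto_zero_iff_norm_tendsto_zero]
    have : ∀ N : ℕ, ‖((N + 1 : ℝ) : ℂ) ^ (1 - s)‖ = ((N + 1 : ℕ) : ℝ) ^ (-(s.re - 1)) := by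
      intro N
      rw [Complex.norm_cpow_eq_rpow_re_of_pos (by positivity)]
      simp
    simp_rw [this]
    exact ((tendsto_rpow_neg_atTop (by linarith : 0 < s.re - 1)).comp tendsto_natCast_atTop_atTop).comp
      (tendsto_add_atTop_nat 1)
  have hpart : ∀ N : ℕ, ∑ n ∈ Finset.range N, zetaTerm n s =
      (s - 1) * ∑ n ∈ Finset.range N, 1 / ((n : ℂ) + 1) ^ s - 1 + ((N + 1 : ℝ) : ℂ) ^ (1 - s) := by
    intro N
    induction N with
    | zero => simp
    | succ N ih =>
      rw [Finset.sum_range_succ, ih, Finset.sum_range_succ, zetaTerm, Complex.cpow_neg]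
      push_cast
      rw [show (N : ℂ) + 1 + 1 = N + 2 by ring]
      ring
  have h1 := hsum.hasSum.tendsto_sum_nat
  simp_rw [hpart] at h1
  have h2 := ((hz.hasSum.tendsto_sum_nat.const_mul (s - 1)).sub_const 1).add hlim
  rw [tendsto_nhds_unique h1 h2, zetaMulSubOne_of_ne hs1, zeta_eq_tsum_one_div_nat_add_one_cpow hs]
  ring

lemma zetaMulSubOne_eq {s : ℂ} (hs : 63 / 64 < s.re) :
    zetaMulSubOne s = 1 + ∑' n, zetaTerm n s := by
  set U : Set ℂ := {z | 63 / 64 < z.re} ∩ Metric.ball 0 (‖s‖ + 3) with hU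
  have hUo : IsOpen U := (isOpen_lt continuous_const Complex.continuous_re).inter Metric.isOpen_ball
  have hUc : IsPreconnected U :=
    ((convex_halfSpace_re_gt _).inter (convex_ball _ _)).isPreconnected
  have hd : DifferentiableOn ℂ (fun z ↦ ∑' n, zetaTerm n z) U := by
    refine Complex.differentiableOn_tsum_of_summable_norm
      (u := fun n : ℕ ↦ (‖s‖ + 4) * (2 * (‖s‖ + 3) ^ (1 / 32 : ℝ)) * (n + 1 : ℝ) ^ (-65 / 64 : ℝ))
      (summable_add_one_rpow.mul_left _)
      (fun n ↦ (differentiable_zetaTerm n).differentiableOn) hUo (fun n z hz ↦ ?_)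
    refine (norm_zetaTerm_le n hz.1.le).trans ?_
    have : ‖z‖ ≤ ‖s‖ + 3 := by simpa using (mem_ball_zero_iff.mp hz.2).le
    have : ‖z - 1‖ ≤ ‖s‖ + 4 := (norm_sub_le _ _).trans (by rw [norm_one]; linarith)
    gcongr
  have h2 : (2 : ℂ) ∈ U := by
    refine ⟨by norm_num, ?_⟩
    rw [mem_ball_zero_iff]
    have := norm_nonneg s
    norm_num
    linarith
  refine AnalyticOnNhd.eqOn_of_preconnected_of_eventuallyEq (z₀ := 2)
    (differentiable_zetaMulSubOne.differentiableOn.analyticOnNhd hUo)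
    ((hd.const_add 1).analyticOnNhd hUo) hUc h2 ?_ ⟨hs, by simp⟩
  filter_upwards [(isOpen_lt continuous_const Complex.continuous_re).mem_nhds
    (show (1 : ℝ) < (2 : ℂ).re by norm_num)] with z hz using zetaMulSubOne_eq_of_one_lt hz

lemma exists_norm_riemannZeta_le : ∃ C : ℝ, 0 < C ∧ ∀ s : ℂ, 63 / 64 < s.re → s.re ≤ 3 →
    1 / 2 ≤ |s.im| → ‖riemannZeta s‖ ≤ C * (1 + |s.im|) ^ (1 / 32 : ℝ) := by
  set K := ∑' n : ℕ, (n + 1 : ℝ) ^ (-65 / 64 : ℝ) with hK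
  have hK0 : 0 ≤ K := tsum_nonneg fun n ↦ by positivity
  refine ⟨2 + 2 * 3 ^ (1 / 32 : ℝ) * K, by positivity, fun s h1 h3 ht ↦ ?_⟩
  have hs1 : s ≠ 1 := by rintro rfl; norm_num at ht
  have hsub : 1 / 2 ≤ ‖s - 1‖ := ht.trans (by simpa using Complex.abs_im_le_norm (s - 1))
  have hnorm : ‖s‖ ≤ 3 * (1 + |s.im|) := by
    refine (Complex.norm_le_abs_re_add_abs_im s).trans ?_
    rw [abs_of_pos (by linarith)]
    linarith [abs_nonneg s.im]
  have hH : ‖zetaMulSubOne s‖ ≤ 1 + ‖s - 1‖ * (2 * ‖s‖ ^ (1 / 32 : ℝ)) * K := by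
    rw [zetaMulSubOne_eq h1]
    refine (norm_add_le _ _).trans ?_
    rw [norm_one, hK, ← tsum_mul_left]
    gcongr
    exact tsum_of_norm_bounded (summable_add_one_rpow.mul_left _).hasSum
      (fun n ↦ norm_zetaTerm_le n h1.le)
  rw [zetaMulSubOne_of_ne hs1, norm_mul] at hH
  have hT : 1 ≤ (1 + |s.im|) ^ (1 / 32 : ℝ) :=
    Real.one_le_rpow (by linarith [abs_nonneg s.im]) (by norm_num)
  have hn : ‖s‖ ^ (1 / 32 : ℝ) ≤ 3 ^ (1 / 32 : ℝ) * (1 + |s.im|) ^ (1 / 32 : ℝ) := by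
    rw [← Real.mul_rpow (by norm_num) (by positivity)]
    gcongr
  have : ‖s - 1‖ * ‖riemannZeta s‖ ≤ ‖s - 1‖ * (2 + 2 * ‖s‖ ^ (1 / 32 : ℝ) * K) := by
    nlinarith
  have := le_of_mul_le_mul_left this (by linarith)
  refine this.trans ?_
  nlinarith [mul_le_mul_of_nonneg_right hn hK0]

lemma exists_norm_iteratedDeriv_riemannZeta_le (k : ℕ) : ∃ C : ℝ, 0 < C ∧ ∀ s : ℂ, 1 ≤ s.re →
    s.re ≤ 2 → 1 ≤ |s.im| →
    ‖iteratedDeriv k riemannZeta s‖ ≤ C * (1 + |s.im|) ^ (1 / 32 : ℝ) := by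
  obtain ⟨C, hC, h⟩ := exists_norm_riemannZeta_le
  refine ⟨k.factorial * (C * 2 ^ (1 / 32 : ℝ)) / (1 / 128) ^ k, by positivity, fun s h1 h2 ht ↦ ?_⟩
  have hre (z : ℂ) : |z.re - s.re| ≤ dist z s := by
    rw [Complex.dist_eq, ← Complex.sub_re]; exact Complex.abs_re_le_norm _
  have him (z : ℂ) : |z.im - s.im| ≤ dist z s := by
    rw [Complex.dist_eq, ← Complex.sub_im]; exact Complex.abs_im_le_norm _
  have hd : DifferentiableOn ℂ riemannZeta (Metric.closedBall s (1 / 128)) := by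
    intro z hz
    refine (differentiableAt_riemannZeta ?_).differentiableWithinAt
    rintro rfl
    have := (him 1).trans (Metric.mem_closedBall.mp hz)
    simp at this
    linarith
  have := Complex.norm_iteratedDeriv_le_of_forall_mem_sphere_norm_le k (c := s) (R := 1 / 128)
    (f := riemannZeta) (C := C * 2 ^ (1 / 32 : ℝ) * (1 + |s.im|) ^ (1 / 32 : ℝ)) (by norm_num)
    (hd.mono Metric.closure_ball_subset_closedBall).diffContOnCl (fun z hz ↦ ?_)
  · refine this.trans (le_of_eq ?_)
    ring
  · have hz' : dist z s = 1 / 128 := hz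
    have h3 := abs_le.mp ((hre z).trans hz'.le)
    have h4 := (him z).trans hz'.le
    have h5 := abs_sub_abs_le_abs_sub z.im s.im
    have h6 := abs_sub_abs_le_abs_sub s.im z.im
    rw [abs_sub_comm] at h6
    refine (h z (by linarith) (by linarith) (by linarith)).trans ?_
    rw [mul_assoc, ← Real.mul_rpow (by norm_num) (by positivity)]
    gcongr
    linarith

lemma norm_riemannZeta_product_ge_one {x : ℝ} (hx : 0 < x) (y : ℝ) :
    1 ≤ ‖riemannZeta (1 + x)‖ ^ 3 * ‖riemannZeta (1 + x + Complex.I * y)‖ ^ 4 *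
      ‖riemannZeta (1 + x + 2 * Complex.I * y)‖ := by
  have := DirichletCharacter.norm_LFunction_product_ge_one (1 : DirichletCharacter ℂ 1) hx y
  simpa [DirichletCharacter.LFunctionTrivChar, DirichletCharacter.LFunction_modOne_eq] using this

lemma exists_norm_riemannZeta_one_add_le : ∃ C : ℝ, 0 < C ∧ ∀ x : ℝ, 0 < x → x ≤ 1 →
    x * ‖riemannZeta (1 + x)‖ ≤ C := by
  have hc : ContinuousOn (fun x : ℝ ↦ zetaMulSubOne (1 + x)) (Icc 0 1) := by
    have := differentiable_zetaMulSubOne.continuous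
    fun_prop
  obtain ⟨C, hC⟩ := isCompact_Icc.exists_bound_of_continuousOn hc
  refine ⟨max C 1, by positivity, fun x h0 h1 ↦ le_max_of_le_left ?_⟩
  have := hC x ⟨h0.le, h1⟩
  rwa [zetaMulSubOne_of_ne (by simpa using h0.ne'), add_sub_cancel_left, norm_mul, Complex.norm_real,
    Real.norm_of_nonneg h0.le] at this

lemma exists_mul_pow_three_le_norm_riemannZeta : ∃ a : ℝ, 0 < a ∧ ∀ x t : ℝ, 0 < x → x ≤ 1 →
    1 ≤ |t| → a * x ^ 3 ≤ ‖riemannZeta (1 + x + Complex.I * t)‖ ^ 4 * (1 + |t|) ^ (1 / 32 : ℝ) := by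
  obtain ⟨A, hA, hA'⟩ := exists_norm_riemannZeta_one_add_le
  obtain ⟨B, hB, hB'⟩ := exists_norm_riemannZeta_le
  refine ⟨1 / (A ^ 3 * (B * 2 ^ (1 / 32 : ℝ))), by positivity, fun x t h0 h1 ht ↦ ?_⟩
  have hp := norm_riemannZeta_product_ge_one h0 t
  have hz := hB' (1 + x + 2 * Complex.I * t) (by simp; linarith) (by simp; linarith)
    (by simp [abs_mul]; linarith)
  have him : (1 + x + 2 * Complex.I * t : ℂ).im = 2 * t := by simp
  rw [him, abs_mul, abs_of_pos (by norm_num : (0 : ℝ) < 2)] at hz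
  set T := (1 + |t|) ^ (1 / 32 : ℝ) with hT
  have hz' : ‖riemannZeta (1 + x + 2 * Complex.I * t)‖ ≤ B * 2 ^ (1 / 32 : ℝ) * T := by
    refine hz.trans ?_
    rw [mul_assoc, hT, ← Real.mul_rpow (by norm_num) (by positivity)]
    gcongr
    linarith
  set y := ‖riemannZeta (1 + x + Complex.I * t)‖ ^ 4
  rw [div_mul_eq_mul_div, one_mul, div_le_iff₀ (by positivity)]
  calc x ^ 3 ≤ x ^ 3 * (‖riemannZeta (1 + x)‖ ^ 3 * y *
        ‖riemannZeta (1 + x + 2 * Complex.I * t)‖) := le_mul_of_one_le_right (by positivity) hp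
    _ = (x * ‖riemannZeta (1 + x)‖) ^ 3 * y * ‖riemannZeta (1 + x + 2 * Complex.I * t)‖ := by ring
    _ ≤ A ^ 3 * y * (B * 2 ^ (1 / 32 : ℝ) * T) := by
      gcongr
      exact hA' x h0 h1
    _ = _ := by ring

lemma exists_le_norm_riemannZeta : ∃ c : ℝ, 0 < c ∧ ∀ s : ℂ, 1 < s.re → s.re ≤ 2 → 1 ≤ |s.im| →
    c ≤ ‖riemannZeta s‖ * ((1 + |s.im|) ^ (1 / 32 : ℝ)) ^ 4 := by
  obtain ⟨a, ha, ha'⟩ := exists_mul_pow_three_le_norm_riemannZeta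
  obtain ⟨D, hD, hD'⟩ := exists_norm_iteratedDeriv_riemannZeta_le 1
  simp only [iteratedDeriv_one] at hD'
  set κ := min 1 (a / (16 * D ^ 4)) with hκ
  have hκ0 : 0 < κ := by positivity
  refine ⟨D * κ, by positivity, fun s h1 h2 ht ↦ ?_⟩
  set T := (1 + |s.im|) ^ (1 / 32 : ℝ) with hT
  have hT1 : 1 ≤ T := Real.one_le_rpow (by linarith) (by norm_num)
  set η := κ / T ^ 5 with hη
  have hη0 : 0 < η := by positivity
  have hη1 : η ≤ 1 := div_le_one_of_le₀
    ((min_le_left _ _).trans (one_le_pow₀ hT1)) (by positivity)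
  set x := max (s.re - 1) η with hx
  have hx1 : x ≤ 1 := max_le (by linarith) hη1
  have hx0 : 0 < x := lt_max_of_lt_right hη0
  have hlow := ha' x s.im hx0 hx1 ht
  set w : ℂ := 1 + x + Complex.I * s.im with hw
  have hwre : w.re = 1 + x := by simp [w]
  have hwim : w.im = s.im := by simp [w]
  have hlow2 : 2 * D * κ / T ^ 4 ≤ ‖riemannZeta w‖ := by
    refine le_of_pow_le_pow_left₀ (n := 4) (by norm_num) (norm_nonneg _) ?_
    have e1 : a * κ ^ 3 / T ^ 15 ≤ ‖riemannZeta w‖ ^ 4 * T := by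
      refine le_trans ?_ hlow
      have : η ^ 3 ≤ x ^ 3 := by gcongr; exact le_max_right _ _
      have e : a * κ ^ 3 / T ^ 15 = a * η ^ 3 := by rw [hη]; field_simp
      rw [e]
      gcongr
    have e2 : 16 * D ^ 4 * κ ≤ a := by
      have := min_le_right 1 (a / (16 * D ^ 4))
      rw [← hκ, le_div_iff₀ (by positivity)] at this
      linarith
    have e3 : (2 * D * κ / T ^ 4) ^ 4 * T = (16 * D ^ 4 * κ) * κ ^ 3 / T ^ 15 := by field_simp; ring
    have e4 : (2 * D * κ / T ^ 4) ^ 4 * T ≤ ‖riemannZeta w‖ ^ 4 * T := by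
      rw [e3]
      refine le_trans ?_ e1
      gcongr
    exact le_of_mul_le_mul_right e4 (by linarith)
  have hdiff : ‖riemannZeta w - riemannZeta s‖ ≤ D * T * ‖w - s‖ := by
    refine Convex.norm_image_sub_le_of_norm_deriv_le (𝕜 := ℂ)
      (s := {z : ℂ | 1 ≤ z.re} ∩ {z | z.re ≤ 2} ∩ {z | z.im = s.im}) (fun z hz ↦ ?_) (fun z hz ↦ ?_)
      (((convex_halfSpace_re_ge _).inter (convex_halfSpace_re_le _)).inter (convex_hyperplane
        Complex.imLm.isLinear _)) ⟨⟨h1.le, h2⟩, rfl⟩ ⟨⟨?_, ?_⟩, hwim⟩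
    · refine differentiableAt_riemannZeta ?_
      rintro rfl
      have := hz.2
      simp only [mem_ofPred_eq, Complex.one_im] at this
      rw [← this] at ht
      norm_num at ht
    · have := hD' z hz.1.1 hz.1.2 (by rw [hz.2]; exact ht)
      rwa [hz.2] at this
    · simp [hwre, hx0.le]
    · simp only [mem_ofPred_eq, hwre]; linarith
  have hws : ‖w - s‖ ≤ η := by
    have : w - s = ((1 + x - s.re : ℝ) : ℂ) := by
      apply Complex.ext <;> simp [w]
    rw [this, Complex.norm_real, Real.norm_of_nonneg (by linarith [le_max_left (s.re - 1) η])]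
    have : x ≤ s.re - 1 + η := max_le (by linarith) (by linarith)
    linarith
  have h3 : ‖riemannZeta w - riemannZeta s‖ ≤ D * κ / T ^ 4 := by
    refine hdiff.trans ?_
    calc D * T * ‖w - s‖ ≤ D * T * η := by gcongr
      _ = D * κ / T ^ 4 := by rw [hη]; field_simp
  have h4 := norm_sub_norm_le (riemannZeta w) (riemannZeta s)
  rw [← div_le_iff₀ (by positivity)]
  have e5 : 2 * D * κ / T ^ 4 = D * κ / T ^ 4 + D * κ / T ^ 4 := by ring
  linarith

/-- Minus the logarithmic derivative of `ζ`, minus `ζ`. -/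
noncomputable def logDerivZetaAddZeta (s : ℂ) : ℂ :=
  -deriv riemannZeta s / riemannZeta s - riemannZeta s

lemma iteratedDeriv_two_logDerivZetaAddZeta {s : ℂ} (hs : 1 < s.re) :
    iteratedDeriv 2 logDerivZetaAddZeta s =
      -iteratedDeriv 3 riemannZeta s / riemannZeta s
      + 3 * iteratedDeriv 2 riemannZeta s * iteratedDeriv 1 riemannZeta s / riemannZeta s ^ 2
      - 2 * iteratedDeriv 1 riemannZeta s ^ 3 / riemannZeta s ^ 3
      - iteratedDeriv 2 riemannZeta s := by
  have hU : IsOpen {z : ℂ | 1 < z.re} := isOpen_lt continuous_const Complex.continuous_re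
  have hne : ∀ z : ℂ, 1 < z.re → z ≠ 1 := by rintro z hz rfl; simp at hz
  have han : AnalyticOnNhd ℂ riemannZeta {z : ℂ | 1 < z.re} :=
    DifferentiableOn.analyticOnNhd
      (fun z hz ↦ (differentiableAt_riemannZeta (hne z hz)).differentiableWithinAt) hU
  have hd (k : ℕ) {z : ℂ} (hz : 1 < z.re) :
      HasDerivAt (iteratedDeriv k riemannZeta) (iteratedDeriv (k + 1) riemannZeta z) z := by
    rw [iteratedDeriv_succ]
    have := (han.iterated_deriv k z hz).differentiableAt.hasDerivAt
    rwa [← iteratedDeriv_eq_iterate] at this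
  have hz0 {z : ℂ} (hz : 1 < z.re) : riemannZeta z ≠ 0 := riemannZeta_ne_zero_of_one_le_re hz.le
  have h0 {z : ℂ} (hz : 1 < z.re) : HasDerivAt riemannZeta (iteratedDeriv 1 riemannZeta z) z := by
    simpa using hd 0 hz
  have h1 {z : ℂ} (hz : 1 < z.re) : deriv logDerivZetaAddZeta z =
      (-iteratedDeriv 2 riemannZeta z * riemannZeta z
        - -iteratedDeriv 1 riemannZeta z * iteratedDeriv 1 riemannZeta z) / riemannZeta z ^ 2
        - iteratedDeriv 1 riemannZeta z := by
    have := (((hd 1 hz).neg.div (h0 hz) (hz0 hz)).sub (h0 hz)).deriv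
    have e : logDerivZetaAddZeta = -iteratedDeriv 1 riemannZeta / riemannZeta - riemannZeta := by
      ext w
      simp [logDerivZetaAddZeta]
    rw [e]
    exact this
  rw [iteratedDeriv_succ, iteratedDeriv_one]
  have hev : deriv logDerivZetaAddZeta =ᶠ[nhds s] fun z ↦ (-iteratedDeriv 2 riemannZeta z * riemannZeta z
        - -iteratedDeriv 1 riemannZeta z * iteratedDeriv 1 riemannZeta z) / riemannZeta z ^ 2
        - iteratedDeriv 1 riemannZeta z := by
    filter_upwards [hU.mem_nhds hs] with z hz using h1 hz
  rw [hev.deriv_eq]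
  have := (((((hd 2 hs).neg.mul (h0 hs)).sub ((hd 1 hs).neg.mul (hd 1 hs))).div ((h0 hs).pow 2)
    (pow_ne_zero 2 (hz0 hs))).sub (hd 1 hs)).deriv
  refine Eq.trans (this) ?_
  have := hz0 hs
  simp only [Pi.neg_apply, Pi.mul_apply, Pi.pow_apply, Pi.sub_apply]
  field_simp
  push_cast
  ring

lemma exists_norm_iteratedDeriv_two_le_of_one_le_im : ∃ C : ℝ, 0 < C ∧ ∀ s : ℂ, 1 < s.re →
    s.re ≤ 2 → 1 ≤ |s.im| →
    ‖iteratedDeriv 2 logDerivZetaAddZeta s‖ ≤ C * (1 + |s.im|) ^ (1 / 2 : ℝ) := by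
  obtain ⟨c, hc, hc'⟩ := exists_le_norm_riemannZeta
  obtain ⟨D1, hD1, hD1'⟩ := exists_norm_iteratedDeriv_riemannZeta_le 1
  obtain ⟨D2, hD2, hD2'⟩ := exists_norm_iteratedDeriv_riemannZeta_le 2
  obtain ⟨D3, hD3, hD3'⟩ := exists_norm_iteratedDeriv_riemannZeta_le 3
  refine ⟨D3 / c + 3 * D2 * D1 / c ^ 2 + 2 * D1 ^ 3 / c ^ 3 + D2, by positivity,
    fun s h1 h2 ht ↦ ?_⟩
  have hT16 : ((1 + |s.im|) ^ (1 / 32 : ℝ)) ^ 16 = (1 + |s.im|) ^ (1 / 2 : ℝ) := by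
    rw [← Real.rpow_natCast, ← Real.rpow_mul (by positivity)]
    norm_num
  rw [← hT16, iteratedDeriv_two_logDerivZetaAddZeta h1]
  have hc := hc' s h1 h2 ht
  have hD1 := hD1' s h1.le h2 ht
  have hD2 := hD2' s h1.le h2 ht
  have hD3 := hD3' s h1.le h2 ht
  set T := (1 + |s.im|) ^ (1 / 32 : ℝ) with hT
  have hT1 : 1 ≤ T := Real.one_le_rpow (by linarith) (by norm_num)
  have hz : c / T ^ 4 ≤ ‖riemannZeta s‖ := by rwa [div_le_iff₀ (by positivity)]
  refine (norm_sub_le _ _).trans ?_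
  rw [add_mul]
  refine add_le_add ((norm_sub_le _ _).trans ?_) (hD2.trans ?_)
  · rw [add_mul]
    refine add_le_add ((norm_add_le _ _).trans ?_) ?_
    · rw [add_mul]
      refine add_le_add ?_ ?_
      · rw [norm_div, norm_neg]
        calc _ ≤ D3 * T / (c / T ^ 4) := by gcongr
          _ = D3 / c * T ^ 5 := by field_simp
          _ ≤ _ := by gcongr; norm_num
      · rw [norm_div, norm_mul, norm_mul, norm_pow, Complex.norm_ofNat]
        calc _ ≤ 3 * (D2 * T) * (D1 * T) / (c / T ^ 4) ^ 2 := by gcongr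
          _ = 3 * D2 * D1 / c ^ 2 * T ^ 10 := by field_simp
          _ ≤ _ := by gcongr; norm_num
    · rw [norm_div, norm_mul, norm_pow, norm_pow, Complex.norm_ofNat]
      calc _ ≤ 2 * (D1 * T) ^ 3 / (c / T ^ 4) ^ 3 := by gcongr
          _ = 2 * D1 ^ 3 / c ^ 3 * T ^ 15 := by field_simp
          _ ≤ _ := by gcongr; norm_num
  · gcongr
    exact le_self_pow₀ hT1 (by norm_num)

lemma exists_norm_iteratedDeriv_two_le : ∃ C : ℝ, 0 < C ∧ ∀ s : ℂ, 1 < s.re → s.re ≤ 2 →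
    ‖iteratedDeriv 2 logDerivZetaAddZeta s‖ ≤ C * (1 + |s.im|) ^ (1 / 2 : ℝ) := by
  obtain ⟨C, hC, hC'⟩ := exists_norm_iteratedDeriv_two_le_of_one_le_im
  set G : ℂ → ℂ := fun s ↦ -deriv zetaMulSubOne s / zetaMulSubOne s - dslope zetaMulSubOne 1 s
    with hG
  set V : Set ℂ := {z | zetaMulSubOne z ≠ 0}
  have hV : IsOpen V := isOpen_ne_fun differentiable_zetaMulSubOne.continuous continuous_const
  have hGd : DifferentiableOn ℂ G V := by
    have h1 := differentiable_zetaMulSubOne.differentiableOn.deriv isOpen_univ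
    have h2 := (Complex.differentiableOn_dslope (c := 1) (f := zetaMulSubOne) univ_mem).mpr
      differentiable_zetaMulSubOne.differentiableOn
    exact ((h1.neg.mono (subset_univ _)).div differentiable_zetaMulSubOne.differentiableOn
      (fun z hz ↦ hz)).sub (h2.mono (subset_univ _))
  have hGc : ContinuousOn (iteratedDeriv 2 G) V := by
    rw [iteratedDeriv_eq_iterate]
    exact ((hGd.analyticOnNhd hV).iterated_deriv 2).continuousOn
  have hK : IsCompact (Icc (1 : ℝ) 2 ×ℂ Icc (-1 : ℝ) 1) := isCompact_Icc.reProdIm isCompact_Icc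
  obtain ⟨M, hM⟩ := hK.exists_bound_of_continuousOn
    (hGc.mono fun z hz ↦ zetaMulSubOne_ne_zero hz.1.1)
  refine ⟨max C M, by positivity, fun s h1 h2 ↦ ?_⟩
  have hT : 1 ≤ (1 + |s.im|) ^ (1 / 2 : ℝ) :=
    Real.one_le_rpow (by linarith [abs_nonneg s.im]) (by norm_num)
  rcases le_total 1 |s.im| with ht | ht
  · refine (hC' s h1 h2 ht).trans ?_
    gcongr
    exact le_max_left _ _
  · have hev : logDerivZetaAddZeta =ᶠ[nhds s] G := by
      filter_upwards [(isOpen_lt continuous_const Complex.continuous_re).mem_nhds h1] with z hz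
      have hz1 : z ≠ 1 := by rintro rfl; simp at hz
      have hz0 : z - 1 ≠ 0 := sub_ne_zero.mpr hz1
      have hzz : riemannZeta z ≠ 0 := riemannZeta_ne_zero_of_one_le_re (le_of_lt hz)
      have hder : deriv zetaMulSubOne z = riemannZeta z + (z - 1) * deriv riemannZeta z := by
        have he : zetaMulSubOne =ᶠ[nhds z] fun s ↦ (s - 1) * riemannZeta s := by
          filter_upwards [isOpen_ne.mem_nhds hz1] with w hw using zetaMulSubOne_of_ne hw
        rw [he.deriv_eq]
        have := (((hasDerivAt_id z).sub_const 1).mul (differentiableAt_riemannZeta hz1).hasDerivAt).deriv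
        simpa [Pi.mul_def] using this
      simp only [hG, logDerivZetaAddZeta]
      rw [hder, dslope_of_ne _ hz1, slope_def_field, zetaMulSubOne_one, zetaMulSubOne_of_ne hz1]
      field_simp
      ring
    rw [hev.iteratedDeriv_eq]
    refine (hM s ⟨⟨h1.le, h2⟩, abs_le.mp ht⟩).trans ?_
    exact (le_max_right C M).trans (le_mul_of_one_le_right (by positivity) hT)

lemma norm_one_div_sub_one_div_add_one_le {σ : ℝ} (hσ : 1 ≤ σ) (y : ℝ) :
    ‖1 / ((σ : ℂ) + y * Complex.I) - 1 / ((σ : ℂ) + y * Complex.I + 1)‖ ≤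
      2 * (1 + ‖y‖) ^ (-2 : ℝ) := by
  set s : ℂ := (σ : ℂ) + y * Complex.I with hs
  have hre : s.re = σ := by simp [hs]
  have him : s.im = y := by simp [hs]
  have h0 : s ≠ 0 := by
    intro h
    rw [h] at hre
    simp at hre
    linarith
  have h1 : s + 1 ≠ 0 := by
    intro h
    have := congrArg Complex.re h
    simp [hre] at this
    linarith
  have e : 1 / s - 1 / (s + 1) = (s * (s + 1))⁻¹ := by
    field_simp
    ring
  have hn : 1 + y ^ 2 ≤ ‖s‖ ^ 2 := by
    rw [← Complex.normSq_eq_norm_sq, Complex.normSq_apply, hre, him]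
    nlinarith
  have hn' : ‖s‖ ≤ ‖s + 1‖ := by
    rw [← sq_le_sq₀ (norm_nonneg _) (norm_nonneg _), ← Complex.normSq_eq_norm_sq,
      ← Complex.normSq_eq_norm_sq, Complex.normSq_apply, Complex.normSq_apply]
    simp only [Complex.add_re, Complex.one_re, Complex.add_im, Complex.one_im, hre, him]
    nlinarith
  have hmul : (1 + ‖y‖) ^ 2 / 2 ≤ ‖s * (s + 1)‖ := by
    rw [norm_mul, Real.norm_eq_abs]
    have h4 : ‖s‖ ^ 2 ≤ ‖s‖ * ‖s + 1‖ := by nlinarith [norm_nonneg s]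
    nlinarith [sq_abs y, sq_nonneg (1 - |y|)]
  rw [e, norm_inv, Real.rpow_neg (by positivity), Real.rpow_two]
  have hp : 0 < (1 + ‖y‖) ^ 2 / 2 := by positivity
  calc ‖s * (s + 1)‖⁻¹ ≤ ((1 + ‖y‖) ^ 2 / 2)⁻¹ := inv_anti₀ hp hmul
    _ = 2 * ((1 + ‖y‖) ^ 2)⁻¹ := by rw [inv_div]; ring

lemma add_ofReal_mul_I_ne_zero {σ : ℝ} (hσ : 0 < σ) (y : ℝ) :
    (σ : ℂ) + y * Complex.I ≠ 0 := by
  intro h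
  have := congrArg Complex.re h
  simp at this
  linarith

lemma continuous_one_div_sub_one_div_add_one {σ : ℝ} (hσ : 1 ≤ σ) :
    Continuous fun y : ℝ ↦
      1 / ((σ : ℂ) + y * Complex.I) - 1 / ((σ : ℂ) + y * Complex.I + 1) := by
  refine Continuous.sub (Continuous.div₀ continuous_const (by fun_prop) fun y ↦ ?_)
    (Continuous.div₀ continuous_const (by fun_prop) fun y ↦ ?_)
  · exact add_ofReal_mul_I_ne_zero (by linarith) y
  · have := add_ofReal_mul_I_ne_zero (σ := σ + 1) (by linarith) y
    push_cast at this
    convert this using 1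
    ring

lemma integrable_one_div_sub_one_div_add_one {σ : ℝ} (hσ : 1 ≤ σ) :
    Integrable fun y : ℝ ↦
      1 / ((σ : ℂ) + y * Complex.I) - 1 / ((σ : ℂ) + y * Complex.I + 1) := by
  have h : Integrable (fun y : ℝ ↦ 2 * (1 + ‖y‖) ^ (-2 : ℝ)) :=
    (integrable_one_add_norm (by simp)).const_mul 2
  exact h.mono' (continuous_one_div_sub_one_div_add_one hσ).aestronglyMeasurable
    (Eventually.of_forall (norm_one_div_sub_one_div_add_one_le hσ))

lemma integral_cpow_mul_one_div_sub {σ : ℝ} (hσ : 1 ≤ σ) {t : ℝ} (ht : 0 < t) :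
    ∫ y : ℝ, (t : ℂ) ^ (-((σ : ℂ) + y * Complex.I)) *
      (1 / ((σ : ℂ) + y * Complex.I) - 1 / ((σ : ℂ) + y * Complex.I + 1)) =
        2 * π * (max (1 - t) 0 : ℝ) := by
  set f : ℝ → ℂ := fun t ↦ indicator (Ioc 0 1) (fun _ ↦ 1 : ℝ → ℂ) t -
    indicator (Ioc 0 1) (fun t ↦ (t : ℂ) ^ (1 : ℂ) : ℝ → ℂ) t with hf
  have hm : ∀ s : ℂ, 0 < s.re → HasMellin f s (1 / s - 1 / (s + 1)) := fun s hs ↦ by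
    have h1 := hasMellin_one_Ioc hs
    have h2 := hasMellin_cpow_Ioc 1 (s := s) (by simp; linarith)
    have := hasMellin_sub h1.1 h2.1
    rwa [h1.2, h2.2] at this
  have hfe : ∀ u : ℝ, 0 < u → f u = ((max (1 - u) 0 : ℝ) : ℂ) := fun u hu ↦ by
    by_cases h : u ≤ 1
    · have : u ∈ Ioc (0 : ℝ) 1 := ⟨hu, h⟩
      simp [hf, this, max_eq_left (sub_nonneg.2 h)]
    · have : u ∉ Ioc (0 : ℝ) 1 := fun h' ↦ h h'.2
      have h3 : 1 - u ≤ 0 := by linarith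
      simp [hf, this, max_eq_right h3]
  have hre : ∀ y : ℝ, 0 < ((σ : ℂ) + y * Complex.I).re := fun y ↦ by simp; linarith
  have hmel : ∀ y : ℝ, mellin f ((σ : ℂ) + y * Complex.I) =
      1 / ((σ : ℂ) + y * Complex.I) - 1 / ((σ : ℂ) + y * Complex.I + 1) := fun y ↦
    (hm _ (hre y)).2
  have hcont : ContinuousAt f t := by
    have : ContinuousAt (fun u : ℝ ↦ ((max (1 - u) 0 : ℝ) : ℂ)) t := by fun_prop
    refine this.congr ?_
    filter_upwards [lt_mem_nhds ht] with u hu using (hfe u hu).symm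
  have key := mellinInv_mellin_eq σ f ht (hm σ (by simp; linarith)).1
    (by
      unfold Complex.VerticalIntegrable
      simp only [hmel]
      exact integrable_one_div_sub_one_div_add_one hσ) hcont
  rw [hfe t ht] at key
  simp only [mellinInv, hmel, smul_eq_mul, Complex.real_smul] at key
  have : (π : ℂ) ≠ 0 := by exact_mod_cast Real.pi_ne_zero
  rw [← key, ← mul_assoc]
  push_cast
  rw [mul_one_div_cancel (by simp [this]), one_mul]

lemma exists_norm_sum_mul_one_sub_le : ∃ K : ℝ, 0 < K ∧ ∀ (a : ℕ → ℂ) (σ X C : ℝ), 1 ≤ σ →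
    0 < X → 0 < C → LSeriesSummable a σ →
    (∀ y : ℝ, ‖LSeries a ((σ : ℂ) + y * Complex.I)‖ ≤ C * (1 + |y|) ^ (1 / 2 : ℝ)) →
    ‖∑ n ∈ Finset.Icc 1 ⌊X⌋₊, a n * ((1 - n / X : ℝ) : ℂ)‖ ≤ C * K * X ^ σ := by
  set J : ℝ := ∫ y : ℝ, 2 * (1 + ‖y‖) ^ (-(3 / 2) : ℝ) with hJ
  have hJi : Integrable fun y : ℝ ↦ 2 * (1 + ‖y‖) ^ (-(3 / 2) : ℝ) :=
    (integrable_one_add_norm (by norm_num)).const_mul 2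
  have hJ0 : 0 ≤ J := integral_nonneg fun y ↦ by positivity
  refine ⟨J + 1, by positivity, fun a σ X C hσ hX hC hsum hbd ↦ ?_⟩
  set k : ℝ → ℂ := fun y ↦
    1 / ((σ : ℂ) + y * Complex.I) - 1 / ((σ : ℂ) + y * Complex.I + 1) with hk
  have hki : Integrable k := integrable_one_div_sub_one_div_add_one hσ
  have hkc : Continuous k := continuous_one_div_sub_one_div_add_one hσ
  set F : ℕ → ℝ → ℂ := fun n y ↦
    LSeries.term a ((σ : ℂ) + y * Complex.I) n * ((X : ℂ) ^ ((σ : ℂ) + y * Complex.I) * k y)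
    with hF
  have hre : ∀ y : ℝ, ((σ : ℂ) + y * Complex.I).re = σ := fun y ↦ by simp
  have hXn : ∀ y : ℝ, ‖(X : ℂ) ^ ((σ : ℂ) + y * Complex.I)‖ = X ^ σ := fun y ↦ by
    rw [Complex.norm_cpow_eq_rpow_re_of_pos hX, hre]
  have htn : ∀ (n : ℕ) (y : ℝ), ‖LSeries.term a ((σ : ℂ) + y * Complex.I) n‖ =
      ‖LSeries.term a σ n‖ := fun n y ↦ by
    rw [LSeries.norm_term_eq, LSeries.norm_term_eq, hre, Complex.ofReal_re]
  have hFn : ∀ n y, ‖F n y‖ = ‖LSeries.term a σ n‖ * X ^ σ * ‖k y‖ := fun n y ↦ by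
    rw [hF, norm_mul, norm_mul, hXn, htn, mul_assoc]
  have hXc : Continuous fun y : ℝ ↦ (X : ℂ) ^ ((σ : ℂ) + y * Complex.I) :=
    Continuous.const_cpow (by fun_prop) (Or.inl (by exact_mod_cast hX.ne'))
  have htc : ∀ n, Continuous fun y : ℝ ↦ LSeries.term a ((σ : ℂ) + y * Complex.I) n := fun n ↦ by
    rcases Nat.eq_zero_or_pos n with rfl | hn
    · simpa using continuous_const
    · have hn' : (n : ℂ) ≠ 0 := by exact_mod_cast hn.ne'
      simp only [LSeries.term_of_ne_zero hn.ne']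
      exact Continuous.div₀ continuous_const (Continuous.const_cpow (by fun_prop) (Or.inl hn'))
        fun y ↦ by simp [Complex.cpow_eq_zero_iff, hn']
  have hFint : ∀ n, Integrable (F n) := fun n ↦ by
    refine (hki.norm.const_mul (‖LSeries.term a σ n‖ * X ^ σ)).mono'
      ((htc n).mul (hXc.mul hkc)).aestronglyMeasurable (Eventually.of_forall fun y ↦ ?_)
    exact (hFn n y).le
  have hFsum : Summable fun n ↦ ∫ y, ‖F n y‖ := by
    simp only [hFn, integral_const_mul]
    exact (hsum.norm.mul_right _).mul_right _
  have hS := hasSum_integral_of_summable_integral_norm hFint hFsum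
  have hval : ∀ n, ∫ y, F n y =
      if n = 0 then 0 else a n * (2 * π * ((max (1 - n / X) 0 : ℝ) : ℂ)) := fun n ↦ by
    split_ifs with hn
    · simp [hF, hn]
    · have hn' : (0 : ℝ) < n := by exact_mod_cast Nat.pos_of_ne_zero hn
      rw [← integral_cpow_mul_one_div_sub hσ (div_pos hn' hX), ← integral_const_mul]
      congr 1
      ext y
      simp only [hF, LSeries.term_of_ne_zero hn, hk]
      rw [Complex.cpow_neg, Complex.ofReal_div, Complex.div_cpow_ofReal_nonneg hn'.le hX.le,
        Complex.ofReal_natCast]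
      rw [inv_div]
      ring
  have htot : ∫ y, ∑' n, F n y =
      2 * π * ∑ n ∈ Finset.Icc 1 ⌊X⌋₊, a n * ((1 - n / X : ℝ) : ℂ) := by
    rw [← hS.tsum_eq, tsum_eq_sum (s := Finset.Icc 1 ⌊X⌋₊), Finset.mul_sum]
    · refine Finset.sum_congr rfl fun n hn ↦ ?_
      rw [Finset.mem_Icc] at hn
      have : (n : ℝ) ≤ X := (Nat.le_floor_iff hX.le).1 hn.2
      have h3 : 0 ≤ 1 - n / X := by
        rw [sub_nonneg, div_le_one hX]
        exact this
      rw [hval, if_neg (by omega), max_eq_left h3]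
      ring
    · intro n hn
      rw [hval]
      split_ifs with h0
      · rfl
      · have : X < n := by
          by_contra! h
          exact hn (Finset.mem_Icc.2 ⟨by omega, (Nat.le_floor_iff hX.le).2 h⟩)
        have h3 : 1 - n / X ≤ 0 := by
          rw [sub_nonpos, one_le_div hX]
          exact this.le
        rw [max_eq_right h3]
        simp
  have hle : ‖∫ y, ∑' n, F n y‖ ≤ C * X ^ σ * J := by
    rw [hJ, ← integral_const_mul]
    refine norm_integral_le_of_norm_le (hJi.const_mul _) (Eventually.of_forall fun y ↦ ?_)
    have : ∑' n, F n y = LSeries a ((σ : ℂ) + y * Complex.I) *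
        ((X : ℂ) ^ ((σ : ℂ) + y * Complex.I) * k y) := by
      simp only [hF, LSeries, tsum_mul_right]
    rw [this, norm_mul, norm_mul, hXn]
    have e : (1 + ‖y‖) ^ (-(3 / 2) : ℝ) = (1 + |y|) ^ (1 / 2 : ℝ) * (1 + ‖y‖) ^ (-2 : ℝ) := by
      rw [← Real.norm_eq_abs, ← Real.rpow_add (by positivity)]
      norm_num
    rw [e]
    calc _ ≤ C * (1 + |y|) ^ (1 / 2 : ℝ) * (X ^ σ * (2 * (1 + ‖y‖) ^ (-2 : ℝ))) := by
          gcongr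
          · exact hbd y
          · exact norm_one_div_sub_one_div_add_one_le hσ y
      _ = _ := by ring
  rw [htot, norm_mul] at hle
  have h2 : ‖(2 * π : ℂ)‖ = 2 * π := by
    rw [show (2 * π : ℂ) = ((2 * π : ℝ) : ℂ) by push_cast; ring, Complex.norm_real,
      Real.norm_of_nonneg (by positivity)]
  rw [h2] at hle
  have h3 : 1 ≤ 2 * π := by linarith [Real.pi_gt_three]
  have hX0 : 0 ≤ X ^ σ := by positivity
  nlinarith [mul_nonneg (sub_nonneg.2 h3) (norm_nonneg
    (∑ n ∈ Finset.Icc 1 ⌊X⌋₊, a n * ((1 - n / X : ℝ) : ℂ))), mul_nonneg hC.le hX0]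

/-- The summand `(Λ(n) - 1) log² n`. -/
noncomputable def vonMangoldtSubOneMulLogSq (n : ℕ) : ℝ :=
  (ArithmeticFunction.vonMangoldt n - 1) * Real.log n ^ 2

lemma LSeries_vonMangoldt_sub_one {s : ℂ} (hs : 1 < s.re) :
    LSeries ((fun n ↦ (ArithmeticFunction.vonMangoldt n : ℂ)) - 1) s = logDerivZetaAddZeta s := by
  rw [LSeries_sub (ArithmeticFunction.LSeriesSummable_vonMangoldt hs)
    (LSeriesSummable_one_iff.2 hs), LSeries_one_eq_riemannZeta hs,
    ArithmeticFunction.LSeries_vonMangoldt_eq_deriv_riemannZeta_div hs, logDerivZetaAddZeta]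

lemma logMul_logMul_vonMangoldt_sub_one :
    LSeries.logMul^[2] ((fun n ↦ (ArithmeticFunction.vonMangoldt n : ℂ)) - 1) =
      fun n ↦ (vonMangoldtSubOneMulLogSq n : ℂ) := by
  ext n
  simp [LSeries.logMul, vonMangoldtSubOneMulLogSq, ← Complex.natCast_log]
  ring

lemma abscissaOfAbsConv_vonMangoldt_sub_one_lt {s : ℂ} (hs : 1 < s.re) :
    LSeries.abscissaOfAbsConv ((fun n ↦ (ArithmeticFunction.vonMangoldt n : ℂ)) - 1) < s.re := by
  refine lt_of_le_of_lt (LSeries.abscissaOfAbsConv_le_of_forall_lt_LSeriesSummable (x := 1)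
    fun y hy ↦ ?_) (by exact_mod_cast hs)
  have hy' : 1 < (y : ℂ).re := by simpa using hy
  exact (ArithmeticFunction.LSeriesSummable_vonMangoldt hy').sub (LSeriesSummable_one_iff.2 hy')

lemma LSeriesSummable_vonMangoldtSubOneMulLogSq {s : ℂ} (hs : 1 < s.re) :
    LSeriesSummable (fun n ↦ (vonMangoldtSubOneMulLogSq n : ℂ)) s := by
  rw [← logMul_logMul_vonMangoldt_sub_one]
  apply LSeriesSummable_of_abscissaOfAbsConv_lt_re
  rw [LSeries.absicssaOfAbsConv_logPowMul]
  exact abscissaOfAbsConv_vonMangoldt_sub_one_lt hs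

lemma LSeries_vonMangoldtSubOneMulLogSq {s : ℂ} (hs : 1 < s.re) :
    LSeries (fun n ↦ (vonMangoldtSubOneMulLogSq n : ℂ)) s =
      iteratedDeriv 2 logDerivZetaAddZeta s := by
  have h := LSeries_iteratedDeriv 2 (abscissaOfAbsConv_vonMangoldt_sub_one_lt hs)
  rw [logMul_logMul_vonMangoldt_sub_one, neg_one_sq, one_mul] at h
  rw [← h]
  refine Filter.EventuallyEq.iteratedDeriv_eq 2 ?_
  filter_upwards [(isOpen_lt continuous_const Complex.continuous_re).mem_nhds hs] with z hz
    using LSeries_vonMangoldt_sub_one hz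

lemma exists_abs_sum_mul_sub_le : ∃ C : ℝ, 0 < C ∧ ∀ X : ℝ, 3 ≤ X →
    |∑ n ∈ Finset.Ioc 0 ⌊X⌋₊, vonMangoldtSubOneMulLogSq n * (X - n)| ≤ C * X ^ 2 := by
  obtain ⟨K, hK, hP⟩ := exists_norm_sum_mul_one_sub_le
  obtain ⟨C, hC, hbd⟩ := exists_norm_iteratedDeriv_two_le
  refine ⟨C * K * Real.exp 1, by positivity, fun X hX ↦ ?_⟩
  have hX0 : 0 < X := by linarith
  have hlog : 1 ≤ Real.log X := by
    rw [Real.le_log_iff_exp_le hX0]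
    linarith [Real.exp_one_lt_three]
  have hi0 : 0 < (Real.log X)⁻¹ := by positivity
  have hi1 : (Real.log X)⁻¹ ≤ 1 := inv_le_one_of_one_le₀ hlog
  set σ : ℝ := 1 + (Real.log X)⁻¹ with hσ
  have hre : ∀ y : ℝ, ((σ : ℂ) + y * Complex.I).re = σ := fun y ↦ by simp
  have him : ∀ y : ℝ, ((σ : ℂ) + y * Complex.I).im = y := fun y ↦ by simp
  have h := hP (fun n ↦ (vonMangoldtSubOneMulLogSq n : ℂ)) σ X C (by linarith) hX0 hC
    (LSeriesSummable_vonMangoldtSubOneMulLogSq (by simp only [Complex.ofReal_re]; linarith))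
    fun y ↦ by
      have h1 := hbd ((σ : ℂ) + y * Complex.I) (by rw [hre]; linarith) (by rw [hre]; linarith)
      rw [him] at h1
      rwa [LSeries_vonMangoldtSubOneMulLogSq (by rw [hre]; linarith)]
  have hpow : X ^ σ = X * Real.exp 1 := by
    rw [hσ, Real.rpow_add hX0, Real.rpow_one, Real.rpow_def_of_pos hX0, mul_inv_cancel₀ (by positivity)]
  rw [hpow] at h
  have e : ∑ n ∈ Finset.Ioc 0 ⌊X⌋₊, vonMangoldtSubOneMulLogSq n * (X - n) =
      X * ∑ n ∈ Finset.Icc 1 ⌊X⌋₊, vonMangoldtSubOneMulLogSq n * (1 - n / X) := by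
    rw [Finset.mul_sum]
    refine Finset.sum_congr rfl fun n _ ↦ ?_
    field_simp
  rw [e, abs_mul, abs_of_pos hX0]
  have h2 : |∑ n ∈ Finset.Icc 1 ⌊X⌋₊, vonMangoldtSubOneMulLogSq n * (1 - n / X)| ≤
      C * K * (X * Real.exp 1) := by
    rw [← Real.norm_eq_abs, ← Complex.norm_real]
    push_cast at h ⊢
    exact h
  calc _ ≤ X * (C * K * (X * Real.exp 1)) := by gcongr
    _ = _ := by ring

lemma natFloor_sub_natFloor_le {x y : ℝ} (hx : 0 ≤ x) (hxy : x ≤ y) :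
    ((⌊y⌋₊ - ⌊x⌋₊ : ℕ) : ℝ) ≤ y - x + 1 := by
  rw [Nat.cast_sub (Nat.floor_mono hxy)]
  linarith [Nat.floor_le (hx.trans hxy), Nat.lt_floor_add_one x]

lemma mul_sum_le_sum_mul_sub_sub {a : ℕ → ℝ} {x h L : ℝ} (hx : 0 ≤ x) (hh : 0 ≤ h)
    (ha : ∀ n : ℕ, n ≤ x + h → -L ≤ a n) (hL : 0 ≤ L) :
    h * ∑ n ∈ Finset.Ioc 0 ⌊x⌋₊, a n ≤ ∑ n ∈ Finset.Ioc 0 ⌊x + h⌋₊, a n * (x + h - n) -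
      ∑ n ∈ Finset.Ioc 0 ⌊x⌋₊, a n * (x - n) + L * h * (h + 1) := by
  have hle : ⌊x⌋₊ ≤ ⌊x + h⌋₊ := Nat.floor_mono (by linarith)
  rw [← Finset.sum_Ioc_consecutive _ (Nat.zero_le _) hle, Finset.mul_sum]
  have h1 : ∑ n ∈ Finset.Ioc 0 ⌊x⌋₊, a n * (x + h - n) = ∑ n ∈ Finset.Ioc 0 ⌊x⌋₊, h * a n +
      ∑ n ∈ Finset.Ioc 0 ⌊x⌋₊, a n * (x - n) := by
    rw [← Finset.sum_add_distrib]
    exact Finset.sum_congr rfl fun n _ ↦ by ring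
  have h2 : (Finset.Ioc ⌊x⌋₊ ⌊x + h⌋₊).card • (-(L * h)) ≤
      ∑ n ∈ Finset.Ioc ⌊x⌋₊ ⌊x + h⌋₊, a n * (x + h - n) := by
    refine Finset.card_nsmul_le_sum _ _ _ fun n hn ↦ ?_
    rw [Finset.mem_Ioc] at hn
    have hn1 : (n : ℝ) ≤ x + h := (Nat.le_floor_iff (by linarith)).1 hn.2
    have hn2 : x < n := (Nat.floor_lt hx).1 hn.1
    nlinarith [ha n hn1]
  rw [Nat.card_Ioc, nsmul_eq_mul] at h2
  have h3 := natFloor_sub_natFloor_le hx (show x ≤ x + h by linarith)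
  nlinarith [mul_nonneg hL hh]

lemma sum_mul_sub_sub_le_mul_sum {a : ℕ → ℝ} {x h L : ℝ} (hx : h ≤ x) (hh : 0 ≤ h)
    (ha : ∀ n : ℕ, n ≤ x → -L ≤ a n) (hL : 0 ≤ L) :
    ∑ n ∈ Finset.Ioc 0 ⌊x⌋₊, a n * (x - n) - ∑ n ∈ Finset.Ioc 0 ⌊x - h⌋₊, a n * (x - h - n) ≤
      h * ∑ n ∈ Finset.Ioc 0 ⌊x⌋₊, a n + L * h * (h + 1) := by
  have hle : ⌊x - h⌋₊ ≤ ⌊x⌋₊ := Nat.floor_mono (by linarith)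
  have h1 : ∑ n ∈ Finset.Ioc 0 ⌊x⌋₊, a n * (x - n) = h * ∑ n ∈ Finset.Ioc 0 ⌊x⌋₊, a n +
      ∑ n ∈ Finset.Ioc 0 ⌊x⌋₊, a n * (x - h - n) := by
    rw [Finset.mul_sum, ← Finset.sum_add_distrib]
    exact Finset.sum_congr rfl fun n _ ↦ by ring
  rw [h1, ← Finset.sum_Ioc_consecutive (fun n ↦ a n * (x - h - n)) (Nat.zero_le _) hle]
  have h2 : ∑ n ∈ Finset.Ioc ⌊x - h⌋₊ ⌊x⌋₊, a n * (x - h - n) ≤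
      (Finset.Ioc ⌊x - h⌋₊ ⌊x⌋₊).card • (L * h) := by
    refine Finset.sum_le_card_nsmul _ _ _ fun n hn ↦ ?_
    rw [Finset.mem_Ioc] at hn
    have hn1 : (n : ℝ) ≤ x := (Nat.le_floor_iff (by linarith)).1 hn.2
    have hn2 : x - h < n := (Nat.floor_lt (by linarith)).1 hn.1
    nlinarith [ha n hn1]
  rw [Nat.card_Ioc, nsmul_eq_mul] at h2
  have h3 := natFloor_sub_natFloor_le (show 0 ≤ x - h by linarith) (show x - h ≤ x by linarith)
  nlinarith [mul_nonneg hL hh]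

lemma neg_log_sq_le_vonMangoldtSubOneMulLogSq {n : ℕ} {y : ℝ} (hy : n ≤ y) :
    -Real.log y ^ 2 ≤ vonMangoldtSubOneMulLogSq n := by
  have h1 : 0 ≤ ArithmeticFunction.vonMangoldt n := ArithmeticFunction.vonMangoldt_nonneg
  have h2 : Real.log n ^ 2 ≤ Real.log y ^ 2 := by
    rcases Nat.eq_zero_or_pos n with rfl | hn
    · simp; positivity
    · have := Real.log_le_log (by exact_mod_cast hn) hy
      have := Real.log_natCast_nonneg n
      gcongr
  unfold vonMangoldtSubOneMulLogSq
  nlinarith [mul_nonneg h1 (sq_nonneg (Real.log n))]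

lemma exists_abs_sum_vonMangoldtSubOneMulLogSq_le : ∃ C : ℝ, 0 < C ∧ ∀ N : ℕ, 2 ≤ N →
    |∑ n ∈ Finset.Ioc 0 N, vonMangoldtSubOneMulLogSq n| ≤ C * (N * Real.log N) := by
  obtain ⟨C, hC, hbd⟩ := exists_abs_sum_mul_sub_le
  set B : ℝ := ∑ n ∈ Finset.Ioc 0 8, |vonMangoldtSubOneMulLogSq n| with hB
  have hB0 : 0 ≤ B := Finset.sum_nonneg fun _ _ ↦ abs_nonneg _
  refine ⟨5 * C + 8 + B, by positivity, fun N hN ↦ ?_⟩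
  have hNr : (2 : ℝ) ≤ N := by exact_mod_cast hN
  rcases lt_or_ge N 8 with h8 | h8
  · have h1 : |∑ n ∈ Finset.Ioc 0 N, vonMangoldtSubOneMulLogSq n| ≤ B :=
      (Finset.abs_sum_le_sum_abs _ _).trans (Finset.sum_le_sum_of_subset_of_nonneg
        (Finset.Ioc_subset_Ioc le_rfl h8.le) fun _ _ _ ↦ abs_nonneg _)
    have h2 : 1 ≤ N * Real.log N := by
      have := Real.log_le_log (by norm_num) hNr
      nlinarith [Real.log_two_gt_d9]
    nlinarith
  have h8r : (8 : ℝ) ≤ N := by exact_mod_cast h8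
  set l : ℝ := Real.log N with hl
  have hl2 : 2 ≤ l := by
    have h1 : Real.log 8 = 3 * Real.log 2 := by
      rw [show (8 : ℝ) = 2 ^ 3 by norm_num, Real.log_pow]; norm_num
    have := Real.log_le_log (by norm_num) h8r
    linarith [Real.log_two_gt_d9]
  have hlN : l ≤ N := (Real.log_le_self (by positivity))
  have hN0 : (0 : ℝ) < N := by linarith
  set h : ℝ := N / l with hh
  have hlh : h * l = N := by rw [hh]; field_simp
  have hh0 : 0 < h := by positivity
  have hh2 : h ≤ N / 2 := by rw [hh]; gcongr
  have hl2N : Real.log (2 * N) ≤ 2 * l := by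
    rw [Real.log_mul (by norm_num) hN0.ne']
    have := Real.log_le_log (by norm_num) hNr
    linarith
  have hlsq : Real.log (2 * N) ^ 2 ≤ (2 * l) ^ 2 := by
    have : 0 ≤ Real.log (2 * N) := Real.log_nonneg (by linarith)
    gcongr
  have ha : ∀ n : ℕ, (n : ℝ) ≤ 2 * N → -(2 * l) ^ 2 ≤ vonMangoldtSubOneMulLogSq n := fun n hn ↦ by
    linarith [neg_log_sq_le_vonMangoldtSubOneMulLogSq hn]
  have hup := mul_sum_le_sum_mul_sub_sub (x := N) (h := h) (L := (2 * l) ^ 2) hN0.le hh0.le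
    (fun n hn ↦ ha n (by linarith)) (by positivity)
  have hlo := sum_mul_sub_sub_le_mul_sum (x := N) (h := h) (L := (2 * l) ^ 2) (by linarith) hh0.le
    (fun n hn ↦ ha n (by linarith)) (by positivity)
  have b1 := abs_le.1 (hbd N (by linarith))
  have b2 := abs_le.1 (hbd (N + h) (by linarith))
  have b3 := abs_le.1 (hbd (N - h) (by linarith))
  rw [Nat.floor_natCast] at hup hlo b1
  set T : ℝ := ∑ n ∈ Finset.Ioc 0 N, vonMangoldtSubOneMulLogSq n with hT
  have hNl : 0 < N * l := by positivity
  have hsq1 : (N + h) ^ 2 ≤ 4 * (N : ℝ) ^ 2 := by nlinarith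
  have hsq2 : (N - h) ^ 2 ≤ 4 * (N : ℝ) ^ 2 := by nlinarith
  have herr : (2 * l) ^ 2 * h * (h + 1) ≤ 8 * (N * l) * h := by
    have : l * (h + 1) ≤ 2 * N := by linarith
    calc (2 * l) ^ 2 * h * (h + 1) = 4 * l * h * (l * (h + 1)) := by ring
      _ ≤ 4 * l * h * (2 * N) := by gcongr
      _ = _ := by ring
  have hCN : C * (N : ℝ) ^ 2 = C * (N * l) * h := by
    rw [show C * (N * l) * h = C * N * (h * l) by ring, hlh]; ring
  have hu : h * T ≤ h * ((5 * C + 8) * (N * l)) := by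
    nlinarith
  have hlow : h * (-((5 * C + 8) * (N * l))) ≤ h * T := by
    nlinarith
  have hu' := le_of_mul_le_mul_left hu hh0
  have hl' := le_of_mul_le_mul_left hlow hh0
  rw [abs_le]
  constructor <;> nlinarith

/-- The summand `(1_{n prime} log n - 1) log² n`. -/
noncomputable def primeLogSubOneMulLogSq (n : ℕ) : ℝ :=
  ((if n.Prime then Real.log n else 0) - 1) * Real.log n ^ 2

lemma log_le_two_mul_sqrt {x : ℝ} (hx : 0 < x) : Real.log x ≤ 2 * √x := by
  have h1 : Real.log x = 2 * Real.log √x := by rw [Real.log_sqrt hx.le]; ring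
  have := Real.log_le_self (Real.sqrt_nonneg x)
  linarith

lemma exists_abs_sum_primeLogSubOneMulLogSq_le : ∃ C : ℝ, 0 < C ∧ ∀ N : ℕ, 2 ≤ N →
    |∑ n ∈ Finset.Ioc 0 N, primeLogSubOneMulLogSq n| ≤ C * (N * Real.log N) := by
  obtain ⟨C, hC, hbd⟩ := exists_abs_sum_vonMangoldtSubOneMulLogSq_le
  obtain ⟨B, hB⟩ := Chebyshev.psi_sub_theta_le_mul_sqrt
  refine ⟨C + 2 * |B|, by positivity, fun N hN ↦ ?_⟩
  have hN0 : (0 : ℝ) < N := by exact_mod_cast (by omega : 0 < N)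
  have hl0 : 0 ≤ Real.log N := Real.log_natCast_nonneg N
  have hdiff : ∑ n ∈ Finset.Ioc 0 N, vonMangoldtSubOneMulLogSq n -
      ∑ n ∈ Finset.Ioc 0 N, primeLogSubOneMulLogSq n =
      ∑ n ∈ Finset.Ioc 0 N with ¬n.Prime, ArithmeticFunction.vonMangoldt n * Real.log n ^ 2 := by
    rw [Finset.sum_filter, ← Finset.sum_sub_distrib]
    refine Finset.sum_congr rfl fun n _ ↦ ?_
    unfold vonMangoldtSubOneMulLogSq primeLogSubOneMulLogSq
    by_cases hp : n.Prime
    · simp only [hp, not_true_eq_false, if_true, if_false]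
      rw [ArithmeticFunction.vonMangoldt_apply_prime hp]
      ring
    · simp only [hp, not_false_eq_true, if_true, if_false]
      ring
  have hpos : 0 ≤ ∑ n ∈ Finset.Ioc 0 N with ¬n.Prime,
      ArithmeticFunction.vonMangoldt n * Real.log n ^ 2 :=
    Finset.sum_nonneg fun n _ ↦ mul_nonneg ArithmeticFunction.vonMangoldt_nonneg (sq_nonneg _)
  have hle : ∑ n ∈ Finset.Ioc 0 N with ¬n.Prime,
      ArithmeticFunction.vonMangoldt n * Real.log n ^ 2 ≤ |B| * √N * Real.log N ^ 2 := by
    calc _ ≤ ∑ n ∈ Finset.Ioc 0 N with ¬n.Prime,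
          ArithmeticFunction.vonMangoldt n * Real.log N ^ 2 := by
          refine Finset.sum_le_sum fun n hn ↦ ?_
          rw [Finset.mem_filter, Finset.mem_Ioc] at hn
          have h1 := Real.log_le_log (by exact_mod_cast hn.1.1)
            (by exact_mod_cast hn.1.2 : (n : ℝ) ≤ N)
          have h2 := Real.log_natCast_nonneg n
          have := ArithmeticFunction.vonMangoldt_nonneg (n := n)
          gcongr
      _ = (Chebyshev.psi N - Chebyshev.theta N) * Real.log N ^ 2 := by
          rw [Chebyshev.psi_sub_theta_eq_sum_not_prime, Nat.floor_natCast, Finset.sum_mul]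
      _ ≤ _ := by
          gcongr
          refine (hB N).trans ?_
          gcongr
          exact le_abs_self B
  have hsq : |B| * √N * Real.log N ^ 2 ≤ 2 * |B| * (N * Real.log N) := by
    calc |B| * √N * Real.log N ^ 2 = |B| * √N * Real.log N * Real.log N := by ring
      _ ≤ |B| * √N * Real.log N * (2 * √N) := by
          gcongr
          exact log_le_two_mul_sqrt hN0
      _ = 2 * |B| * (√N * √N * Real.log N) := by ring
      _ = _ := by rw [Real.mul_self_sqrt hN0.le]
  have h1 := abs_le.1 (hbd N hN)
  have h2 : 0 ≤ 2 * |B| * (N * Real.log N) := by positivity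
  rw [abs_le]
  constructor <;> nlinarith

lemma sum_Ioc_sub_mul (F g : ℕ → ℝ) {N M : ℕ} (h : N ≤ M) :
    ∑ n ∈ Finset.Ioc N M, (F n - F (n - 1)) * g n = F M * g (M + 1) - F N * g (N + 1) +
      ∑ n ∈ Finset.Ioc N M, F n * (g n - g (n + 1)) := by
  induction M, h using Nat.le_induction with
  | base => simp
  | succ M hM ih =>
    rw [Finset.sum_Ioc_succ_top (by omega), Finset.sum_Ioc_succ_top (by omega), ih,
      Nat.add_sub_cancel]
    ring

lemma abs_sum_Ioc_mul_le {b Φ g : ℕ → ℝ} {N M : ℕ} (h : N ≤ M)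
    (hΦ : ∀ n, N ≤ n → |∑ i ∈ Finset.Ioc 0 n, b i| ≤ Φ n) (hg0 : ∀ n, N ≤ n → 0 ≤ g n)
    (hg : ∀ n, N ≤ n → g (n + 1) ≤ g n) :
    |∑ n ∈ Finset.Ioc N M, b n * g n| ≤
      2 * Φ N * g (N + 1) + ∑ n ∈ Finset.Ioc N M, (Φ n - Φ (n - 1)) * g n := by
  set A : ℕ → ℝ := fun n ↦ ∑ i ∈ Finset.Ioc 0 n, b i with hA
  have e : ∑ n ∈ Finset.Ioc N M, b n * g n = ∑ n ∈ Finset.Ioc N M, (A n - A (n - 1)) * g n := by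
    refine Finset.sum_congr rfl fun n hn ↦ ?_
    rw [Finset.mem_Ioc] at hn
    obtain ⟨m, rfl⟩ : ∃ m, n = m + 1 := ⟨n - 1, by omega⟩
    simp only [hA, Nat.add_sub_cancel]
    rw [Finset.sum_Ioc_succ_top (by omega)]
    ring
  rw [e, sum_Ioc_sub_mul A g h, sum_Ioc_sub_mul Φ g h]
  have h1 : |A M * g (M + 1)| ≤ Φ M * g (M + 1) := by
    rw [abs_mul, abs_of_nonneg (hg0 _ (by omega))]
    exact mul_le_mul_of_nonneg_right (hΦ M h) (hg0 _ (by omega))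
  have h2 : |A N * g (N + 1)| ≤ Φ N * g (N + 1) := by
    rw [abs_mul, abs_of_nonneg (hg0 _ (by omega))]
    exact mul_le_mul_of_nonneg_right (hΦ N le_rfl) (hg0 _ (by omega))
  have h3 : |∑ n ∈ Finset.Ioc N M, A n * (g n - g (n + 1))| ≤
      ∑ n ∈ Finset.Ioc N M, Φ n * (g n - g (n + 1)) := by
    refine (Finset.abs_sum_le_sum_abs _ _).trans (Finset.sum_le_sum fun n hn ↦ ?_)
    rw [Finset.mem_Ioc] at hn
    have hd : 0 ≤ g n - g (n + 1) := sub_nonneg.2 (hg n (by omega))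
    rw [abs_mul, abs_of_nonneg hd]
    exact mul_le_mul_of_nonneg_right (hΦ n (by omega)) hd
  rw [abs_le] at *
  constructor <;> linarith

lemma mul_log_sub_mul_log_le {n : ℕ} (hn : 3 ≤ n) :
    n * Real.log n - ((n - 1 : ℕ) : ℝ) * Real.log ((n - 1 : ℕ) : ℝ) ≤ 3 * Real.log n := by
  obtain ⟨m, rfl⟩ : ∃ m, n = m + 1 := ⟨n - 1, by omega⟩
  have hm : (2 : ℝ) ≤ m := by exact_mod_cast (by omega : 2 ≤ m)
  have hm0 : (0 : ℝ) < m := by linarith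
  rw [Nat.add_sub_cancel]
  push_cast
  have h1 : m * (Real.log (m + 1) - Real.log m) ≤ 1 := by
    rw [← Real.log_div (by positivity) hm0.ne']
    have := Real.log_le_sub_one_of_pos (show 0 < ((m : ℝ) + 1) / m by positivity)
    calc m * Real.log (((m : ℝ) + 1) / m) ≤ m * (((m : ℝ) + 1) / m - 1) := by gcongr
      _ = 1 := by field_simp; ring
  have h2 : Real.log 2 ≤ Real.log (m + 1) := Real.log_le_log (by norm_num) (by linarith)
  nlinarith [Real.log_two_gt_d9]

lemma exists_abs_sum_prime_sub_sum_le : ∃ C : ℝ, 0 < C ∧ ∀ N M : ℕ, 2 ≤ N → N ≤ M →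
    |∑ n ∈ Finset.Ioc N M, ((if n.Prime then Real.log n else 0) - 1) * (1 / (n ^ 2 * Real.log n))|
      ≤ C * (1 / (N * Real.log N ^ 2)) := by
  obtain ⟨C, hC, hbd⟩ := exists_abs_sum_primeLogSubOneMulLogSq_le
  refine ⟨5 * C, by positivity, fun N M hN hNM ↦ ?_⟩
  have hN0 : (0 : ℝ) < N := by exact_mod_cast (by omega : 0 < N)
  have hlog : ∀ n : ℕ, N ≤ n → 0 < Real.log n := fun n hn ↦
    Real.log_pos (by exact_mod_cast (by omega : 1 < n))
  have hmono : ∀ n m : ℕ, N ≤ n → n ≤ m → Real.log n ≤ Real.log m := fun n m hn hm ↦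
    Real.log_le_log (by exact_mod_cast (by omega : 0 < n)) (by exact_mod_cast hm)
  set g : ℕ → ℝ := fun n ↦ 1 / (n ^ 2 * Real.log n ^ 3) with hg
  have h := abs_sum_Ioc_mul_le (b := primeLogSubOneMulLogSq) (Φ := fun n ↦ C * (n * Real.log n))
    (g := g) hNM (fun n hn ↦ hbd n (by omega))
    (fun n hn ↦ by have := hlog n hn; simp only [hg]; positivity)
    (fun n hn ↦ by
      have h1 := hlog n hn
      have h2 := hmono n (n + 1) hn (by omega)
      have h3 : (0 : ℝ) < n := by exact_mod_cast (by omega : 0 < n)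
      have h4 : (n : ℝ) ≤ (n + 1 : ℕ) := by exact_mod_cast Nat.le_succ n
      simp only [hg]
      gcongr)
  have e : ∑ n ∈ Finset.Ioc N M,
      ((if n.Prime then Real.log n else 0) - 1) * (1 / (n ^ 2 * Real.log n)) =
      ∑ n ∈ Finset.Ioc N M, primeLogSubOneMulLogSq n * g n := by
    refine Finset.sum_congr rfl fun n hn ↦ ?_
    rw [Finset.mem_Ioc] at hn
    have := hlog n (by omega)
    simp only [hg, primeLogSubOneMulLogSq]
    field_simp
  rw [e]
  refine h.trans ?_
  have hlN := hlog N le_rfl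
  have b1 : 2 * (C * (N * Real.log N)) * g (N + 1) ≤ 2 * C * (1 / (N * Real.log N ^ 2)) := by
    have h2 := hmono N (N + 1) le_rfl (by omega)
    have h4 : (N : ℝ) ≤ (N + 1 : ℕ) := by exact_mod_cast Nat.le_succ N
    calc 2 * (C * (N * Real.log N)) * g (N + 1)
        ≤ 2 * (C * (N * Real.log N)) * (1 / (N ^ 2 * Real.log N ^ 3)) := by
          simp only [hg]
          gcongr
      _ = _ := by field_simp
  have b2 : ∑ n ∈ Finset.Ioc N M,
      (C * (n * Real.log n) - C * (((n - 1 : ℕ) : ℝ) * Real.log ((n - 1 : ℕ) : ℝ))) * g n ≤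
      3 * C * (1 / (N * Real.log N ^ 2)) := by
    calc _ ≤ ∑ n ∈ Finset.Ioc N M, 3 * C / Real.log N ^ 2 * ((n : ℝ) ^ 2)⁻¹ := by
          refine Finset.sum_le_sum fun n hn ↦ ?_
          rw [Finset.mem_Ioc] at hn
          have h1 := mul_log_sub_mul_log_le (n := n) (by omega)
          have h2 := hmono N n le_rfl (by omega)
          have h3 := hlog n (by omega)
          have h4 : (0 : ℝ) < n := by exact_mod_cast (by omega : 0 < n)
          have hg0 : 0 ≤ g n := by simp only [hg]; positivity
          rw [← mul_sub]
          calc _ ≤ C * (3 * Real.log n) * g n := by gcongr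
            _ = 3 * C / Real.log n ^ 2 * ((n : ℝ) ^ 2)⁻¹ := by simp only [hg]; field_simp
            _ ≤ _ := by gcongr
      _ ≤ 3 * C / Real.log N ^ 2 * (N : ℝ)⁻¹ := by
          rw [← Finset.mul_sum]
          gcongr
          have := sum_Ioc_inv_sq_le_sub (α := ℝ) (by omega : N ≠ 0) hNM
          have h5 : (0 : ℝ) ≤ (M : ℝ)⁻¹ := by positivity
          linarith
      _ = _ := by field_simp
  linarith

lemma abs_sum_inv_sq_mul_log_sub_le {N M : ℕ} (hN : 2 ≤ N) (hNM : N ≤ M) :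
    |∑ n ∈ Finset.Ioc N M, 1 / ((n : ℝ) ^ 2 * Real.log n) - 1 / (N * Real.log N)| ≤
      3 * (1 / (N * Real.log N ^ 2)) + 1 / (M * Real.log M) := by
  have hN0 : (0 : ℝ) < N := by exact_mod_cast (by omega : 0 < N)
  have hlog : ∀ n : ℕ, N ≤ n → 0 < Real.log n := fun n hn ↦
    Real.log_pos (by exact_mod_cast (by omega : 1 < n))
  have hmono : ∀ n m : ℕ, N ≤ n → n ≤ m → Real.log n ≤ Real.log m := fun n m hn hm ↦
    Real.log_le_log (by exact_mod_cast (by omega : 0 < n)) (by exact_mod_cast hm)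
  have hlN := hlog N le_rfl
  have hinv : ∑ n ∈ Finset.Ioc N M, ((n : ℝ) ^ 2)⁻¹ ≤ (N : ℝ)⁻¹ := by
    have := sum_Ioc_inv_sq_le_sub (α := ℝ) (by omega : N ≠ 0) hNM
    have h5 : (0 : ℝ) ≤ (M : ℝ)⁻¹ := by positivity
    linarith
  have hupper : ∑ n ∈ Finset.Ioc N M, 1 / ((n : ℝ) ^ 2 * Real.log n) ≤ 1 / (N * Real.log N) := by
    calc _ ≤ ∑ n ∈ Finset.Ioc N M, (Real.log N)⁻¹ * ((n : ℝ) ^ 2)⁻¹ := by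
          refine Finset.sum_le_sum fun n hn ↦ ?_
          rw [Finset.mem_Ioc] at hn
          have h2 := hmono N n le_rfl (by omega)
          have h4 : (0 : ℝ) < n := by exact_mod_cast (by omega : 0 < n)
          rw [← mul_inv, one_div, mul_comm]
          gcongr
      _ ≤ (Real.log N)⁻¹ * (N : ℝ)⁻¹ := by
          rw [← Finset.mul_sum]
          gcongr
      _ = _ := by field_simp
  set u : ℕ → ℝ := fun n ↦ 1 / (n * Real.log n) with hu
  have hstep : ∀ n : ℕ, N ≤ n → u n - u (n + 1) ≤
      1 / ((n : ℝ) ^ 2 * Real.log n) + (Real.log N ^ 2)⁻¹ * ((n : ℝ) ^ 2)⁻¹ := fun n hn ↦ by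
    have h1 := hlog n hn
    have h2 := hmono n (n + 1) hn (by omega)
    have h3 := hmono N n le_rfl hn
    have h4 : (0 : ℝ) < n := by exact_mod_cast (by omega : 0 < n)
    have h5 : n * (Real.log (n + 1 : ℕ) - Real.log n) ≤ 1 := by
      rw [← Real.log_div (by positivity) h4.ne']
      have := Real.log_le_sub_one_of_pos (show 0 < ((n + 1 : ℕ) : ℝ) / n by positivity)
      calc n * Real.log (((n + 1 : ℕ) : ℝ) / n) ≤ n * (((n + 1 : ℕ) : ℝ) / n - 1) := by gcongr
        _ = 1 := by push_cast; field_simp; ring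
    have h6 : 0 < Real.log (n + 1 : ℕ) := by linarith
    have h7 : (n : ℝ) ≤ (n + 1 : ℕ) := by exact_mod_cast Nat.le_succ n
    calc u n - u (n + 1)
        = (Real.log (n + 1 : ℕ) + n * (Real.log (n + 1 : ℕ) - Real.log n)) /
            (n * (n + 1 : ℕ) * Real.log n * Real.log (n + 1 : ℕ)) := by
          simp only [hu]
          have : ((n + 1 : ℕ) : ℝ) ≠ 0 := by positivity
          field_simp
          push_cast
          ring
      _ ≤ (Real.log (n + 1 : ℕ) + 1) / (n * (n + 1 : ℕ) * Real.log n * Real.log (n + 1 : ℕ)) := by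
          gcongr
      _ = 1 / (n * (n + 1 : ℕ) * Real.log n) +
            1 / (n * (n + 1 : ℕ) * Real.log n * Real.log (n + 1 : ℕ)) := by
          have : ((n + 1 : ℕ) : ℝ) ≠ 0 := by positivity
          field_simp
      _ ≤ 1 / (n * n * Real.log n) + 1 / (n * n * Real.log N * Real.log N) := by
          gcongr
          omega
      _ = _ := by field_simp
  have hlower : u N - u M - (Real.log N ^ 2)⁻¹ * (N : ℝ)⁻¹ -
      (1 / ((N : ℝ) ^ 2 * Real.log N) + (Real.log N ^ 2)⁻¹ * ((N : ℝ) ^ 2)⁻¹) ≤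
      ∑ n ∈ Finset.Ioc N M, 1 / ((n : ℝ) ^ 2 * Real.log n) := by
    have h1 : ∀ K : ℕ, N ≤ K → u (N + 1) - u (K + 1) ≤ ∑ n ∈ Finset.Ioc N K,
        (1 / ((n : ℝ) ^ 2 * Real.log n) + (Real.log N ^ 2)⁻¹ * ((n : ℝ) ^ 2)⁻¹) := fun K hK ↦ by
      induction K, hK using Nat.le_induction with
      | base => simp
      | succ K hK ih =>
        rw [Finset.sum_Ioc_succ_top (by omega)]
        linarith [hstep (K + 1) (by omega)]
    have h2 := h1 M hNM
    rw [Finset.sum_add_distrib, ← Finset.mul_sum] at h2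
    have h3 := hstep N le_rfl
    have h4 : u (M + 1) ≤ u M := by
      have h5 := hlog M hNM
      have h6 := hmono M (M + 1) hNM (by omega)
      have h7 : (0 : ℝ) < M := by exact_mod_cast (by omega : 0 < M)
      have h8 : (M : ℝ) ≤ (M + 1 : ℕ) := by exact_mod_cast Nat.le_succ M
      simp only [hu]
      gcongr
    have h9 : (Real.log N ^ 2)⁻¹ * ∑ n ∈ Finset.Ioc N M, ((n : ℝ) ^ 2)⁻¹ ≤
        (Real.log N ^ 2)⁻¹ * (N : ℝ)⁻¹ := by gcongr
    linarith
  have hNr : (2 : ℝ) ≤ N := by exact_mod_cast hN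
  have hlN' : Real.log N ≤ N := Real.log_le_self hN0.le
  have t1 : 1 / ((N : ℝ) ^ 2 * Real.log N) ≤ 1 / (N * Real.log N ^ 2) := by
    apply one_div_le_one_div_of_le (by positivity)
    have : 0 < N * Real.log N := by positivity
    nlinarith
  have t2 : (Real.log N ^ 2)⁻¹ * ((N : ℝ) ^ 2)⁻¹ ≤ 1 / (N * Real.log N ^ 2) := by
    rw [← mul_inv, ← one_div]
    apply one_div_le_one_div_of_le (by positivity)
    have : 0 < N * Real.log N ^ 2 := by positivity
    nlinarith
  have t3 : (Real.log N ^ 2)⁻¹ * (N : ℝ)⁻¹ = 1 / (N * Real.log N ^ 2) := by field_simp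
  have t4 : 0 ≤ 1 / (N * Real.log N ^ 2) := by positivity
  have t5 : 0 ≤ 1 / (M * Real.log M) := by
    have := hlog M hNM
    positivity
  simp only [hu] at hlower
  rw [abs_le]
  constructor <;> linarith

lemma exists_abs_sum_prime_inv_sq_sub_le : ∃ C : ℝ, 0 < C ∧ ∀ N M : ℕ, 2 ≤ N → N ≤ M →
    |∑ p ∈ Finset.Ioc N M with p.Prime, 1 / (p : ℝ) ^ 2 - 1 / (N * Real.log N)| ≤
      C * (1 / (N * Real.log N ^ 2)) + 1 / (M * Real.log M) := by
  obtain ⟨C, hC, hbd⟩ := exists_abs_sum_prime_sub_sum_le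
  refine ⟨C + 3, by positivity, fun N M hN hNM ↦ ?_⟩
  have h1 := hbd N M hN hNM
  have h2 := abs_sum_inv_sq_mul_log_sub_le hN hNM
  have e : ∑ n ∈ Finset.Ioc N M,
      ((if n.Prime then Real.log n else 0) - 1) * (1 / (n ^ 2 * Real.log n)) =
      ∑ p ∈ Finset.Ioc N M with p.Prime, 1 / (p : ℝ) ^ 2 -
        ∑ n ∈ Finset.Ioc N M, 1 / ((n : ℝ) ^ 2 * Real.log n) := by
    rw [Finset.sum_filter, ← Finset.sum_sub_distrib]
    refine Finset.sum_congr rfl fun n hn ↦ ?_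
    rw [Finset.mem_Ioc] at hn
    have h3 : 0 < Real.log n := Real.log_pos (by exact_mod_cast (by omega : 1 < n))
    have h4 : (0 : ℝ) < n := by exact_mod_cast (by omega : 0 < n)
    split_ifs <;> field_simp
    ring
  rw [e] at h1
  rw [abs_le] at *
  constructor <;> linarith

lemma inv_rpow_two_fifths_le {p : ℕ} (hp : 2 ≤ p) : ((p : ℝ)⁻¹) ^ (2 / 5 : ℝ) ≤ 7 / 8 := by
  have hp' : (2 : ℝ) ≤ p := by exact_mod_cast hp
  have h1 : (p : ℝ)⁻¹ ≤ 1 / 2 := by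
    rw [one_div]
    gcongr
  rw [← pow_le_pow_iff_left₀ (by positivity) (by norm_num) (show 5 ≠ 0 by norm_num),
    ← Real.rpow_natCast, ← Real.rpow_mul (by positivity)]
  norm_num only [Nat.cast_ofNat, Real.rpow_ofNat]
  calc ((p : ℝ)⁻¹) ^ 2 ≤ (1 / 2) ^ 2 := by gcongr
    _ ≤ _ := by norm_num

lemma inv_pow_le_of_lt_pow {p k M : ℕ} (hp : 2 ≤ p) (hM : 1 ≤ M) (h : M < p ^ k) :
    ((p : ℝ)⁻¹) ^ k ≤ (M : ℝ) ^ (-(3 / 5) : ℝ) * (((p : ℝ)⁻¹) ^ (2 / 5 : ℝ)) ^ k := by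
  have hp0 : (0 : ℝ) < p := by exact_mod_cast (by omega : 0 < p)
  have hM0 : (0 : ℝ) < M := by exact_mod_cast hM
  have hq : 0 < ((p : ℝ)⁻¹) ^ k := by positivity
  have h1 : ((p : ℝ)⁻¹) ^ k = (((p : ℝ)⁻¹) ^ k) ^ (3 / 5 : ℝ) * (((p : ℝ)⁻¹) ^ k) ^ (2 / 5 : ℝ) := by
    rw [← Real.rpow_add hq]
    norm_num
  have h2 : (((p : ℝ)⁻¹) ^ k) ^ (2 / 5 : ℝ) = (((p : ℝ)⁻¹) ^ (2 / 5 : ℝ)) ^ k := by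
    rw [← Real.rpow_natCast, ← Real.rpow_natCast, ← Real.rpow_mul (by positivity),
      ← Real.rpow_mul (by positivity), mul_comm]
  have h3 : (((p : ℝ)⁻¹) ^ k) ^ (3 / 5 : ℝ) ≤ (M : ℝ) ^ (-(3 / 5) : ℝ) := by
    rw [Real.rpow_neg hM0.le, ← Real.inv_rpow hM0.le, inv_pow]
    have : (M : ℝ) ≤ (p : ℝ) ^ k := by exact_mod_cast h.le
    gcongr
  calc ((p : ℝ)⁻¹) ^ k = _ := h1
    _ ≤ _ := by rw [h2]; gcongr

lemma neg_log_one_sub_inv_sub_mem_Icc {p M K : ℕ} (hp : 2 ≤ p) (hpM : p ≤ M) (hK : M < 2 ^ K) :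
    -Real.log (1 - (p : ℝ)⁻¹) -
      (∑ k ∈ Finset.Icc 1 K, if p ^ k ≤ M then 1 / ((k : ℝ) * (p : ℝ) ^ k) else 0) -
      (if p ^ 2 ≤ M then 0 else 1 / 2 * (1 / (p : ℝ) ^ 2)) ∈
      Icc 0 (8 * (M : ℝ) ^ (-(3 / 5) : ℝ) * (p : ℝ) ^ (-(6 / 5) : ℝ)) := by
  have hp0 : (0 : ℝ) < p := by exact_mod_cast (by omega : 0 < p)
  have hp1 : (1 : ℝ) < p := by exact_mod_cast (by omega : 1 < p)
  set q : ℝ := (p : ℝ)⁻¹ with hq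
  have hq0 : 0 < q := by positivity
  have hq1 : q < 1 := inv_lt_one_of_one_lt₀ hp1
  have hs := Real.hasSum_pow_div_log_of_abs_lt_one (x := q) (by rwa [abs_of_pos hq0])
  have hfin : HasSum (fun j : ℕ ↦ if p ^ (j + 1) ≤ M then q ^ (j + 1) / (j + 1) else 0)
      (∑ k ∈ Finset.Icc 1 K, if p ^ k ≤ M then 1 / ((k : ℝ) * (p : ℝ) ^ k) else 0) := by
    have e : (∑ k ∈ Finset.Icc 1 K, if p ^ k ≤ M then 1 / ((k : ℝ) * (p : ℝ) ^ k) else 0) =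
        ∑ j ∈ Finset.range K, if p ^ (j + 1) ≤ M then q ^ (j + 1) / (j + 1) else 0 := by
      rw [show Finset.Icc 1 K = Finset.Ico (0 + 1) (K + 1) by ext; simp,
        ← Finset.sum_Ico_add', Finset.range_eq_Ico]
      refine Finset.sum_congr rfl fun j _ ↦ ?_
      simp only [hq, inv_pow]
      split_ifs
      · push_cast
        field_simp
      · rfl
    rw [e]
    refine hasSum_sum_of_ne_finset_zero fun j hj ↦ ?_
    rw [Finset.mem_range, not_lt] at hj
    rw [if_neg]
    rw [not_le]
    calc M < 2 ^ K := hK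
      _ ≤ 2 ^ (j + 1) := Nat.pow_le_pow_right (by norm_num) (by omega)
      _ ≤ p ^ (j + 1) := Nat.pow_le_pow_left hp _
  set S : ℝ := ∑ k ∈ Finset.Icc 1 K, if p ^ k ≤ M then 1 / ((k : ℝ) * (p : ℝ) ^ k) else 0
  have hd := (hasSum_nat_add_iff' 2).2 (hs.sub hfin)
  have e2 : -Real.log (1 - q) - S - (if p ^ 2 ≤ M then 0 else 1 / 2 * (1 / (p : ℝ) ^ 2)) =
      -Real.log (1 - q) - S - ∑ j ∈ Finset.range 2, (q ^ (j + 1) / ((j : ℝ) + 1) -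
        if p ^ (j + 1) ≤ M then q ^ (j + 1) / ((j : ℝ) + 1) else 0) := by
    have h2 : q ^ 2 = 1 / (p : ℝ) ^ 2 := by rw [hq, inv_pow, one_div]
    simp only [Finset.sum_range_succ, Finset.sum_range_zero]
    norm_num [hpM, h2]
    split_ifs <;> ring
  rw [e2]
  set r : ℝ := q ^ (2 / 5 : ℝ) with hr
  have hr0 : 0 ≤ r := by positivity
  have hr1 : r ≤ 7 / 8 := inv_rpow_two_fifths_le hp
  have hg := ((hasSum_geometric_of_lt_one hr0 (by linarith)).mul_left
    ((M : ℝ) ^ (-(3 / 5) : ℝ) * r ^ 3))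
  have hr3 : r ^ 3 = (p : ℝ) ^ (-(6 / 5) : ℝ) := by
    rw [hr, ← Real.rpow_natCast, ← Real.rpow_mul hq0.le, hq, Real.inv_rpow hp0.le,
      ← Real.rpow_neg hp0.le]
    norm_num
  refine ⟨hd.nonneg fun j ↦ ?_, ?_⟩
  · split_ifs
    · simp
    · simp only [sub_zero]
      positivity
  · refine (hasSum_le (fun j ↦ ?_) hd hg).trans ?_
    · split_ifs with h
      · rw [sub_self]
        positivity
      · rw [sub_zero, mul_assoc, ← pow_add, show 3 + j = j + 2 + 1 by ring]
        refine le_trans ?_ (inv_pow_le_of_lt_pow hp (by omega) (not_le.1 h))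
        refine div_le_self (by positivity) ?_
        linarith [Nat.cast_nonneg (α := ℝ) (j + 2)]
    · have h8 : (1 - r)⁻¹ ≤ 8 := by
        rw [inv_le_comm₀ (by linarith) (by norm_num)]
        linarith
      rw [hr3]
      calc _ ≤ (M : ℝ) ^ (-(3 / 5) : ℝ) * (p : ℝ) ^ (-(6 / 5) : ℝ) * 8 := by gcongr
        _ = _ := by ring

lemma sum_vonMangoldt_div_mul_log {M K : ℕ} (hK : M < 2 ^ K) :
    ∑ n ∈ Finset.Iic M, ArithmeticFunction.vonMangoldt n / (n * Real.log n) =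
      ∑ p ∈ Finset.Iic M with p.Prime,
        ∑ k ∈ Finset.Icc 1 K, if p ^ k ≤ M then 1 / ((k : ℝ) * (p : ℝ) ^ k) else 0 := by
  have e1 : ∑ n ∈ Finset.Iic M, ArithmeticFunction.vonMangoldt n / (n * Real.log n) =
      ∑ n ∈ Finset.Iic M with IsPrimePow n,
        ArithmeticFunction.vonMangoldt n / (n * Real.log n) := by
    rw [Finset.sum_filter]
    refine Finset.sum_congr rfl fun n _ ↦ ?_
    split_ifs with h
    · rfl
    · rw [ArithmeticFunction.vonMangoldt_eq_zero_iff.2 h, zero_div]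
  have e2 : ∑ p ∈ Finset.Iic M with p.Prime,
      (∑ k ∈ Finset.Icc 1 K, if p ^ k ≤ M then 1 / ((k : ℝ) * (p : ℝ) ^ k) else 0) =
      ∑ z ∈ (Finset.Iic M).filter Nat.Prime ×ˢ Finset.Icc 1 K with z.1 ^ z.2 ≤ M,
        1 / ((z.2 : ℝ) * (z.1 : ℝ) ^ z.2) := by
    rw [Finset.sum_filter (s := _ ×ˢ _), Finset.sum_product]
  rw [e1, e2]
  symm
  refine Finset.sum_bij (fun z _ ↦ z.1 ^ z.2) (fun z hz ↦ ?_) (fun z hz w hw h ↦ ?_)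
    (fun n hn ↦ ?_) fun z hz ↦ ?_
  · simp only [Finset.mem_filter, Finset.mem_product, Finset.mem_Iic, Finset.mem_Icc] at hz ⊢
    exact ⟨hz.2, hz.1.1.2.isPrimePow.pow (by omega)⟩
  · simp only [Finset.mem_filter, Finset.mem_product, Finset.mem_Icc] at hz hw
    have := hz.1.1.2.pow_inj' hw.1.1.2 (by omega) (by omega) h
    exact Prod.ext this.1 this.2
  · simp only [Finset.mem_filter, Finset.mem_Iic] at hn
    obtain ⟨p, k, hp, hk, rfl⟩ := (isPrimePow_nat_iff n).1 hn.2
    refine ⟨(p, k), ?_, rfl⟩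
    simp only [Finset.mem_filter, Finset.mem_product, Finset.mem_Iic, Finset.mem_Icc]
    refine ⟨⟨⟨(Nat.le_self_pow hk.ne' p).trans hn.1, hp⟩, hk, ?_⟩, hn.1⟩
    by_contra! h
    have h1 : 2 ^ K ≤ 2 ^ k := Nat.pow_le_pow_right (by norm_num) h.le
    have h2 : 2 ^ k ≤ p ^ k := Nat.pow_le_pow_left hp.two_le k
    omega
  · simp only [Finset.mem_filter, Finset.mem_product, Finset.mem_Icc] at hz
    have hk : 0 < z.2 := hz.1.2.1
    have hl : Real.log z.1 ≠ 0 :=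
      (Real.log_pos (by exact_mod_cast hz.1.1.2.one_lt)).ne'
    rw [ArithmeticFunction.vonMangoldt_apply_pow hk.ne',
      ArithmeticFunction.vonMangoldt_apply_prime hz.1.1.2]
    push_cast
    rw [Real.log_pow]
    have h0 : (z.1 : ℝ) ≠ 0 := by exact_mod_cast hz.1.1.2.ne_zero
    have hk' : (z.2 : ℝ) ≠ 0 := by exact_mod_cast hk.ne'
    field_simp

lemma log_mertensProd (x : ℝ) :
    Real.log (mertensProd x) =
      ∑ p ∈ Finset.Iic ⌊x⌋₊ with p.Prime, -Real.log (1 - (p : ℝ)⁻¹) := by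
  rw [mertensProd, Real.log_prod]
  · simp only [Real.log_inv, one_div]
  · intro p hp
    have h1 : (1 : ℝ) < p := by exact_mod_cast (Finset.mem_filter.1 hp).2.one_lt
    have h2 : 1 / (p : ℝ) < 1 := (div_lt_one (by linarith)).2 h1
    exact inv_ne_zero (by linarith)

lemma exists_log_mertensProd_sub_sum_mem_Icc : ∃ Z : ℝ, 0 < Z ∧ ∀ x : ℝ,
    Real.log (mertensProd x) -
      (∑ n ∈ Finset.Iic ⌊x⌋₊, ArithmeticFunction.vonMangoldt n / (n * Real.log n)) -
      1 / 2 * ∑ p ∈ Finset.Ioc (Nat.sqrt ⌊x⌋₊) ⌊x⌋₊ with p.Prime, 1 / (p : ℝ) ^ 2 ∈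
      Icc 0 (Z * (⌊x⌋₊ : ℝ) ^ (-(3 / 5) : ℝ)) := by
  have hsum : Summable fun n : ℕ ↦ (n : ℝ) ^ (-(6 / 5) : ℝ) :=
    Real.summable_nat_rpow.2 (by norm_num)
  set Z : ℝ := ∑' n : ℕ, (n : ℝ) ^ (-(6 / 5) : ℝ) with hZ
  have hZ0 : 0 ≤ Z := tsum_nonneg fun n ↦ by positivity
  refine ⟨8 * Z + 1, by positivity, fun x ↦ ?_⟩
  set M : ℕ := ⌊x⌋₊
  have hsq : ∑ p ∈ Finset.Ioc (Nat.sqrt M) M with p.Prime, 1 / (p : ℝ) ^ 2 =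
      ∑ p ∈ Finset.Iic M with p.Prime, if p ^ 2 ≤ M then 0 else 1 / (p : ℝ) ^ 2 := by
    rw [Finset.sum_filter, Finset.sum_filter]
    refine Finset.sum_subset_zero_on_sdiff (fun p hp ↦ ?_) (fun p hp ↦ ?_) fun p hp ↦ ?_
    · rw [Finset.mem_Iic]
      exact (Finset.mem_Ioc.1 hp).2
    · rw [Finset.mem_sdiff, Finset.mem_Ioc, Finset.mem_Iic] at hp
      have : p ^ 2 ≤ M := by
        rw [← Nat.le_sqrt']
        by_contra h
        exact hp.2 ⟨by omega, hp.1⟩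
      simp [this]
    · have : ¬ p ^ 2 ≤ M := by
        rw [← Nat.le_sqrt', not_le]
        exact (Finset.mem_Ioc.1 hp).1
      simp [this]
  rw [log_mertensProd, sum_vonMangoldt_div_mul_log (K := M) Nat.lt_two_pow_self, hsq,
    Finset.mul_sum, ← Finset.sum_sub_distrib, ← Finset.sum_sub_distrib]
  have key : ∀ p ∈ (Finset.Iic M).filter Nat.Prime, -Real.log (1 - (p : ℝ)⁻¹) -
      (∑ k ∈ Finset.Icc 1 M, if p ^ k ≤ M then 1 / ((k : ℝ) * (p : ℝ) ^ k) else 0) -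
      1 / 2 * (if p ^ 2 ≤ M then 0 else 1 / (p : ℝ) ^ 2) ∈
      Icc 0 (8 * (M : ℝ) ^ (-(3 / 5) : ℝ) * (p : ℝ) ^ (-(6 / 5) : ℝ)) := fun p hp ↦ by
    rw [Finset.mem_filter, Finset.mem_Iic] at hp
    have := neg_log_one_sub_inv_sub_mem_Icc hp.2.two_le hp.1 Nat.lt_two_pow_self
    rwa [mul_ite, mul_zero]
  refine ⟨Finset.sum_nonneg fun p hp ↦ (key p hp).1, ?_⟩
  calc _ ≤ ∑ p ∈ Finset.Iic M with p.Prime,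
        8 * (M : ℝ) ^ (-(3 / 5) : ℝ) * (p : ℝ) ^ (-(6 / 5) : ℝ) :=
        Finset.sum_le_sum fun p hp ↦ (key p hp).2
    _ ≤ 8 * (M : ℝ) ^ (-(3 / 5) : ℝ) * Z := by
        rw [← Finset.mul_sum]
        gcongr
        exact hsum.sum_le_tsum _ fun n _ ↦ by positivity
    _ ≤ _ := by
        have : 0 ≤ (M : ℝ) ^ (-(3 / 5) : ℝ) := by positivity
        linarith

lemma abs_one_div_mul_log_sub_le {N : ℕ} (hN : 2 ≤ N) {s : ℝ} (hs : N ≤ s) (hs' : s ≤ N + 1) :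
    |1 / (N * Real.log N) - 1 / (s * Real.log s)| ≤ 3 * (1 / (N * Real.log N ^ 2)) := by
  have hNr : (2 : ℝ) ≤ N := by exact_mod_cast hN
  have hN0 : (0 : ℝ) < N := by linarith
  have hs0 : 0 < s := by linarith
  have hlN : 0 < Real.log N := Real.log_pos (by linarith)
  have hls : Real.log N ≤ Real.log s := Real.log_le_log hN0 hs
  have hls0 : 0 < Real.log s := by linarith
  have hNlog : Real.log N ≤ N := Real.log_le_self hN0.le
  have h1 : 0 ≤ 1 / (N * Real.log N) - 1 / (s * Real.log s) := by
    rw [sub_nonneg]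
    gcongr
  rw [abs_of_nonneg h1]
  have h5 : N * (Real.log s - Real.log N) ≤ 1 := by
    rw [← Real.log_div (by positivity) hN0.ne']
    have := Real.log_le_sub_one_of_pos (show 0 < s / N by positivity)
    calc N * Real.log (s / N) ≤ N * (s / N - 1) := by gcongr
      _ = s - N := by field_simp
      _ ≤ 1 := by linarith
  have h6 : 1 ≤ 2 * Real.log s := by
    have := Real.log_le_log (by norm_num) (hNr.trans hs)
    linarith [Real.log_two_gt_d9]
  calc 1 / (N * Real.log N) - 1 / (s * Real.log s)
      = ((s - N) * Real.log s + N * (Real.log s - Real.log N)) /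
          (N * Real.log N * (s * Real.log s)) := by
        field_simp
        ring
    _ ≤ (3 * Real.log s) / (N * Real.log N * (s * Real.log s)) := by
        gcongr
        nlinarith
    _ = 3 * (1 / (N * Real.log N * s)) := by field_simp
    _ ≤ 3 * (1 / (N * Real.log N * Real.log N)) := by
        gcongr
        linarith
    _ = _ := by rw [sq, mul_assoc]

lemma log_sq_le_rpow {x : ℝ} (hx : 0 < x) (hx1 : 1 ≤ x) :
    Real.log x ^ 2 ≤ 400 * x ^ (1 / 10 : ℝ) := by
  have h1 := Real.log_le_rpow_div hx.le (show (0 : ℝ) < 1 / 20 by norm_num)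
  have h2 : 0 ≤ Real.log x := Real.log_nonneg hx1
  calc Real.log x ^ 2 ≤ (x ^ (1 / 20 : ℝ) / (1 / 20)) ^ 2 := by gcongr
    _ = 400 * (x ^ (1 / 20 : ℝ)) ^ 2 := by ring
    _ = _ := by
      rw [← Real.rpow_natCast, ← Real.rpow_mul hx.le]
      norm_num

lemma natFloor_rpow_neg_three_fifths_le {x : ℝ} (hx : 2 ≤ x) :
    (⌊x⌋₊ : ℝ) ^ (-(3 / 5) : ℝ) ≤ 800 / (√x * Real.log x ^ 2) := by
  have hx0 : 0 < x := by linarith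
  have hM : x / 2 ≤ ⌊x⌋₊ := by linarith [Nat.lt_floor_add_one x]
  have hl : 0 < Real.log x := Real.log_pos (by linarith)
  have h2 : (2 : ℝ) ^ (3 / 5 : ℝ) ≤ 2 := by
    calc (2 : ℝ) ^ (3 / 5 : ℝ) ≤ 2 ^ (1 : ℝ) := by gcongr <;> norm_num
      _ = 2 := Real.rpow_one 2
  calc (⌊x⌋₊ : ℝ) ^ (-(3 / 5) : ℝ) ≤ (x / 2) ^ (-(3 / 5) : ℝ) :=
        Real.rpow_le_rpow_of_nonpos (by positivity) hM (by norm_num)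
    _ = 2 ^ (3 / 5 : ℝ) / x ^ (3 / 5 : ℝ) := by
        rw [Real.rpow_neg (by positivity), Real.div_rpow hx0.le (by norm_num), inv_div]
    _ ≤ 2 / x ^ (3 / 5 : ℝ) := by gcongr
    _ = 800 / (√x * (400 * x ^ (1 / 10 : ℝ))) := by
        have : x ^ (3 / 5 : ℝ) = √x * x ^ (1 / 10 : ℝ) := by
          rw [Real.sqrt_eq_rpow, ← Real.rpow_add hx0]
          norm_num
        rw [this]
        field_simp
        norm_num
    _ ≤ _ := by
        gcongr
        exact log_sq_le_rpow hx0 (by linarith)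

lemma natSqrt_natFloor_le_sqrt {x : ℝ} (hx : 0 ≤ x) : (Nat.sqrt ⌊x⌋₊ : ℝ) ≤ √x := by
  apply Real.le_sqrt_of_sq_le
  have h1 : ((Nat.sqrt ⌊x⌋₊ ^ 2 : ℕ) : ℝ) ≤ (⌊x⌋₊ : ℝ) := by exact_mod_cast Nat.sqrt_le' _
  push_cast at h1
  exact h1.trans (Nat.floor_le hx)

lemma sqrt_le_natSqrt_natFloor_add_one (x : ℝ) : √x ≤ Nat.sqrt ⌊x⌋₊ + 1 := by
  rw [Real.sqrt_le_left (by positivity)]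
  have h1 : ((⌊x⌋₊ + 1 : ℕ) : ℝ) ≤ (((Nat.sqrt ⌊x⌋₊ + 1) ^ 2 : ℕ) : ℝ) := by
    exact_mod_cast Nat.succ_le_succ_sqrt' _
  push_cast at h1
  exact (Nat.lt_floor_add_one x).le.trans h1

lemma exists_abs_half_sum_sub_le : ∃ C : ℝ, 0 < C ∧ ∀ x : ℝ, 4 ≤ x →
    |1 / 2 * ∑ p ∈ Finset.Ioc (Nat.sqrt ⌊x⌋₊) ⌊x⌋₊ with p.Prime, 1 / (p : ℝ) ^ 2 -
      1 / (√x * Real.log x)| ≤ C / (√x * Real.log x ^ 2) := by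
  obtain ⟨C, hC, hbd⟩ := exists_abs_sum_prime_inv_sq_sub_le
  refine ⟨16 * (C + 4), by positivity, fun x hx ↦ ?_⟩
  have hx0 : 0 ≤ x := by linarith
  set M : ℕ := ⌊x⌋₊
  set N : ℕ := Nat.sqrt M
  have hM4 : 4 ≤ M := Nat.le_floor (by exact_mod_cast hx)
  have hN : 2 ≤ N := Nat.le_sqrt.2 (by omega)
  have hNr : (2 : ℝ) ≤ N := by exact_mod_cast hN
  have hNs : (N : ℝ) ≤ √x := natSqrt_natFloor_le_sqrt hx0
  have hsN : √x ≤ N + 1 := sqrt_le_natSqrt_natFloor_add_one x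
  have hlN : 0 < Real.log N := Real.log_pos (by linarith)
  have hNlog : Real.log N ≤ N := Real.log_le_self (by linarith)
  have hlog : Real.log x = 2 * Real.log √x := by rw [Real.log_sqrt hx0]; ring
  have hls : Real.log √x ≤ 2 * Real.log N := by
    calc Real.log √x ≤ Real.log ((N : ℝ) ^ 2) :=
          Real.log_le_log (by linarith) (by nlinarith)
      _ = _ := by rw [Real.log_pow]; norm_num
  have hlx : 0 < Real.log √x := Real.log_pos (by linarith)
  have h1 := hbd N M hN (Nat.sqrt_le_self M)
  have h2 := abs_one_div_mul_log_sub_le hN hNs hsN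
  have h3 : 1 / (M * Real.log M) ≤ 1 / (N * Real.log N ^ 2) := by
    have hMN : (N : ℝ) * N ≤ M := by exact_mod_cast Nat.sqrt_le M
    have hl : Real.log N ≤ Real.log M := Real.log_le_log (by linarith) (by nlinarith)
    rw [sq, ← mul_assoc]
    gcongr
    exact le_trans (by gcongr) hMN
  have h4 : 1 / (N * Real.log N ^ 2) ≤ 32 / (√x * Real.log x ^ 2) := by
    rw [div_le_div_iff₀ (by positivity) (by rw [hlog]; positivity), hlog]
    have h5 : √x ≤ 2 * N := by linarith
    calc 1 * (√x * (2 * Real.log √x) ^ 2) ≤ 1 * (2 * N * (2 * (2 * Real.log N)) ^ 2) := by gcongr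
      _ = 32 * (N * Real.log N ^ 2) := by ring
  have h6 : 1 / (√x * Real.log x) = 1 / 2 * (1 / (√x * Real.log √x)) := by
    rw [hlog]
    field_simp
  have h7 : 16 * (C + 4) / (√x * Real.log x ^ 2) =
      (C + 4) / 2 * (32 / (√x * Real.log x ^ 2)) := by ring
  rw [h6, h7, ← mul_sub, abs_mul, abs_of_pos (by norm_num : (0 : ℝ) < 1 / 2)]
  have h8 : (C + 4) * (1 / (N * Real.log N ^ 2)) ≤ (C + 4) * (32 / (√x * Real.log x ^ 2)) := by
    gcongr
  have h9 := abs_sub_le (∑ p ∈ Finset.Ioc N M with p.Prime, 1 / (p : ℝ) ^ 2)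
    (1 / (N * Real.log N)) (1 / (√x * Real.log √x))
  linarith

/-- `log ∏_{p≤x}(1-1/p)⁻¹ = ∑_{n≤x} Λ(n)/(n log n) + 1/(√x log x) + O(1/(√x (log x)²))`. -/
theorem log_mertensProd_eq_sum_vonMangoldt :
    ∃ C : ℝ, 0 < C ∧ ∀ x : ℝ, 2 ≤ x →
      |Real.log (mertensProd x) -
          (∑ n ∈ Finset.Iic ⌊x⌋₊, ArithmeticFunction.vonMangoldt n / (n * Real.log n)) -
          1 / (Real.sqrt x * Real.log x)| ≤
        C / (Real.sqrt x * (Real.log x) ^ 2) := by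
  obtain ⟨Z, hZ, hD⟩ := exists_log_mertensProd_sub_sum_mem_Icc
  obtain ⟨C, hC, hP⟩ := exists_abs_half_sum_sub_le
  refine ⟨C + 800 * Z + 24, by positivity, fun x hx ↦ ?_⟩
  have hx0 : 0 < x := by linarith
  have hl : 0 < Real.log x := Real.log_pos (by linarith)
  have hden : 0 < √x * Real.log x ^ 2 := by positivity
  set P : ℝ := 1 / 2 * ∑ p ∈ Finset.Ioc (Nat.sqrt ⌊x⌋₊) ⌊x⌋₊ with p.Prime, 1 / (p : ℝ) ^ 2
    with hP_def
  obtain ⟨hD0, hD1⟩ := hD x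
  have hE : Z * (⌊x⌋₊ : ℝ) ^ (-(3 / 5) : ℝ) ≤ 800 * Z / (√x * Real.log x ^ 2) := by
    calc _ ≤ Z * (800 / (√x * Real.log x ^ 2)) := by
          gcongr
          exact natFloor_rpow_neg_three_fifths_le hx
      _ = _ := by ring
  have hP' : |P - 1 / (√x * Real.log x)| ≤ (C + 24) / (√x * Real.log x ^ 2) := by
    rcases le_or_gt 4 x with h4 | h4
    · refine (hP x h4).trans ?_
      gcongr
      linarith
    · have hs2 : √x ≤ 2 := by
        rw [Real.sqrt_le_left (by norm_num)]
        linarith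
      have hs1 : 1 ≤ √x := Real.one_le_sqrt.2 (by linarith)
      have hlow : 1 / 2 ≤ Real.log x := by
        have := Real.log_le_log (by norm_num) hx
        linarith [Real.log_two_gt_d9]
      have hup : Real.log x ≤ 2 := by
        have h6 : Real.log x ≤ Real.log (2 ^ 2) := Real.log_le_log hx0 (by linarith)
        rw [Real.log_pow] at h6
        push_cast at h6
        linarith [Real.log_two_lt_d9]
      have hP0 : 0 ≤ P := by positivity
      have hP1 : P ≤ 1 := by
        have hN : 1 ≤ Nat.sqrt ⌊x⌋₊ := Nat.le_sqrt.2 (Nat.le_floor (by push_cast; linarith))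
        have h7 : ∑ p ∈ Finset.Ioc (Nat.sqrt ⌊x⌋₊) ⌊x⌋₊ with p.Prime, 1 / (p : ℝ) ^ 2 ≤
            ∑ p ∈ Finset.Ioc (Nat.sqrt ⌊x⌋₊) ⌊x⌋₊, ((p : ℝ) ^ 2)⁻¹ := by
          simp only [one_div]
          exact Finset.sum_le_sum_of_subset_of_nonneg (Finset.filter_subset _ _)
            fun _ _ _ ↦ by positivity
        have h8 := sum_Ioc_inv_sq_le_sub (α := ℝ) (by omega : Nat.sqrt ⌊x⌋₊ ≠ 0)
          (Nat.sqrt_le_self _)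
        have h9 : ((Nat.sqrt ⌊x⌋₊ : ℝ))⁻¹ ≤ 1 := inv_le_one_of_one_le₀ (by exact_mod_cast hN)
        have h10 : (0 : ℝ) ≤ (⌊x⌋₊ : ℝ)⁻¹ := by positivity
        linarith
      have hm0 : 0 ≤ 1 / (√x * Real.log x) := by positivity
      have hm1 : 1 / (√x * Real.log x) ≤ 2 := by
        rw [div_le_iff₀ (by positivity)]
        nlinarith
      have hd8 : √x * Real.log x ^ 2 ≤ 8 := by
        calc √x * Real.log x ^ 2 ≤ 2 * 2 ^ 2 := by gcongr
          _ = 8 := by norm_num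
      have h24 : 3 ≤ (C + 24) / (√x * Real.log x ^ 2) := by
        rw [le_div_iff₀ hden]
        linarith
      rw [abs_le]
      constructor <;> linarith
  have hsplit : (C + 800 * Z + 24) / (√x * Real.log x ^ 2) =
      (C + 24) / (√x * Real.log x ^ 2) + 800 * Z / (√x * Real.log x ^ 2) := by ring
  have hZ0 : 0 ≤ 800 * Z / (√x * Real.log x ^ 2) := by positivity
  rw [hsplit]
  rw [abs_le] at hP' ⊢
  constructor <;> linarith
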